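/- Let 𝒯 be a regular T-mesh occupying the rectangle Ω and let 𝒯^ε be an extension of 𝒯 associated with S(2,2,1,1,𝒯). Then S(2,2,1,1,𝒯) = { f̄|_Ω : f̄ ∈ S̄(2,2,1,1,𝒯^ε) }, and the restriction map f̄ ↦ f̄|_Ω from S̄(2,2,1,1,𝒯^ε) to S(2,2,1,1,𝒯) is a linear isomorphism; in particular dim S(2,2,1,1,𝒯) = dim S̄(2,2,1,1,𝒯^ε). -/

import Mathlib

open Filter Set MeasureTheory
open scoped Topology

noncomputable section

/-- A closed axis-aligned rectangle with positive side lengths. -/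
structure Rect where
  xmin : ℝ
  xmax : ℝ
  ymin : ℝ
  ymax : ℝ
  hx : xmin < xmax
  hy : ymin < ymax

/-- The set of points of a rectangle. -/
def Rect.toSet (c : Rect) : Set (ℝ × ℝ) :=
  Set.Icc c.xmin c.xmax ×ˢ Set.Icc c.ymin c.ymax

/-- A regular T-mesh: finitely many cells (closed axis-aligned rectangles) with pairwise
disjoint interiors whose union is a closed axis-aligned rectangle. -/
structure TMesh where
  cells : Set Rect
  outer : Rect
  finite_cells : cells.Finite
  pairwise_disjoint : cells.Pairwise fun c d => Disjoint (interior c.toSet) (interior d.toSet)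
  union_eq : (⋃ c ∈ cells, c.toSet) = outer.toSet

/-- The region occupied by a T-mesh. -/
def TMesh.Omega (T : TMesh) : Set (ℝ × ℝ) := T.outer.toSet

/-- The edge skeleton of a T-mesh: the union of the boundaries of all cells. -/
def TMesh.skeleton (T : TMesh) : Set (ℝ × ℝ) := ⋃ c ∈ T.cells, frontier c.toSet

/-- A vertex of the mesh: a corner of some cell. -/
def IsVertexOf (T : TMesh) (p : ℝ × ℝ) : Prop :=
  ∃ c ∈ T.cells, (p.1 = c.xmin ∨ p.1 = c.xmax) ∧ (p.2 = c.ymin ∨ p.2 = c.ymax)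

/-- A crossing vertex: an interior vertex from which four small axis-parallel segments
stay inside the edge skeleton. -/
def IsCrossingVertex (T : TMesh) (p : ℝ × ℝ) : Prop :=
  IsVertexOf T p ∧ p ∈ interior T.Omega ∧
    ∃ ε > (0 : ℝ), segment ℝ p (p + (ε, 0)) ⊆ T.skeleton ∧
      segment ℝ p (p - (ε, 0)) ⊆ T.skeleton ∧
      segment ℝ p (p + (0, ε)) ⊆ T.skeleton ∧
      segment ℝ p (p - (0, ε)) ⊆ T.skeleton

/-- A horizontal closed segment of positive length. -/
def IsHorizSeg (s : Set (ℝ × ℝ)) : Prop :=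
  ∃ a b y : ℝ, a < b ∧ s = Set.Icc a b ×ˢ ({y} : Set ℝ)

/-- A vertical closed segment of positive length. -/
def IsVertSeg (s : Set (ℝ × ℝ)) : Prop :=
  ∃ x a b : ℝ, a < b ∧ s = ({x} : Set ℝ) ×ˢ Set.Icc a b

/-- An l-edge: a maximal axis-parallel closed segment of positive length contained in the
edge skeleton. -/
def IsLEdge (T : TMesh) (s : Set (ℝ × ℝ)) : Prop :=
  (IsHorizSeg s ∨ IsVertSeg s) ∧ s ⊆ T.skeleton ∧
    ∀ s', (IsHorizSeg s' ∨ IsVertSeg s') → s' ⊆ T.skeleton → s ⊆ s' → s' = s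

def IsBoundaryLEdge (T : TMesh) (s : Set (ℝ × ℝ)) : Prop :=
  IsLEdge T s ∧ s ⊆ frontier T.Omega

def IsInteriorLEdge (T : TMesh) (s : Set (ℝ × ℝ)) : Prop :=
  IsLEdge T s ∧ ¬ s ⊆ frontier T.Omega

/-- There is a horizontal l-edge with endpoints `(a,y)`, `(b,y)`. -/
def HorizLEdgeAt (T : TMesh) (a b y : ℝ) : Prop :=
  a < b ∧ IsLEdge T (Set.Icc a b ×ˢ ({y} : Set ℝ))

/-- The number `V⁺` of crossing vertices. -/
def crossingCount (T : TMesh) : ℕ := {p | IsCrossingVertex T p}.ncard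

/-- The number `E` of interior l-edges. -/
def interiorLEdgeCount (T : TMesh) : ℕ := {s | IsInteriorLEdge T s}.ncard

/-- The number `F` of cells. -/
def cellCount (T : TMesh) : ℕ := T.cells.ncard

/-! Partial derivatives (within a set) and smoothness. -/

def pdXW (S : Set (ℝ × ℝ)) (f : ℝ × ℝ → ℝ) : ℝ × ℝ → ℝ :=
  fun p => derivWithin (fun x => f (x, p.2)) {x | (x, p.2) ∈ S} p.1

def pdYW (S : Set (ℝ × ℝ)) (f : ℝ × ℝ → ℝ) : ℝ × ℝ → ℝ :=
  fun p => derivWithin (fun y => f (p.1, y)) {y | (p.1, y) ∈ S} p.2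

/-- The mixed partial derivative `∂^{i+j} f/∂x^i∂y^j`, taken within the set `S`. -/
def mpW (S : Set (ℝ × ℝ)) (i j : ℕ) (f : ℝ × ℝ → ℝ) : ℝ × ℝ → ℝ :=
  (pdYW S)^[j] ((pdXW S)^[i] f)

/-- `f` has continuous mixed partials `∂^{i+j}f/∂x^i∂y^j` on `S` for all `0 ≤ i ≤ α`,
`0 ≤ j ≤ β` (smoothness indices `α, β ∈ ℤ` may be `-1`, in which case nothing is required
in that variable). -/
def SmoothWithin (S : Set (ℝ × ℝ)) (α β : ℤ) (f : ℝ × ℝ → ℝ) : Prop :=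
  (∀ i j : ℕ, (i : ℤ) ≤ α → (j : ℤ) ≤ β → ContinuousOn (mpW S i j f) S) ∧
  (∀ i : ℕ, (i : ℤ) < α → ∀ p ∈ S,
    HasDerivWithinAt (fun x => (pdXW S)^[i] f (x, p.2)) ((pdXW S)^[i+1] f p)
      {x | (x, p.2) ∈ S} p.1) ∧
  (∀ i j : ℕ, (i : ℤ) ≤ α → (j : ℤ) < β → ∀ p ∈ S,
    HasDerivWithinAt (fun y => mpW S i j f (p.1, y)) (mpW S i (j+1) f p)
      {y | (p.1, y) ∈ S} p.2)

/-- `f` agrees on each cell of `T` with a polynomial of bidegree at most `(m,n)`. -/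
def PiecewisePoly (m n : ℕ) (T : TMesh) (f : ℝ × ℝ → ℝ) : Prop :=
  ∀ c ∈ T.cells, ∃ p : MvPolynomial (Fin 2) ℝ,
    p.degreeOf 0 ≤ m ∧ p.degreeOf 1 ≤ n ∧
    ∀ q ∈ c.toSet, f q = MvPolynomial.eval ![q.1, q.2] p

/-- The spline space with homogeneous boundary conditions `S̄(m,n,α,β,T)`. -/
def SBar (m n : ℕ) (α β : ℤ) (T : TMesh) : Set (ℝ × ℝ → ℝ) :=
  {f | (∀ p, p ∉ T.Omega → f p = 0) ∧ PiecewisePoly m n T f ∧ SmoothWithin Set.univ α β f}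

/-- The spline space `S(m,n,α,β,T)` over the T-mesh: membership only constrains the values
on the occupied region `Ω` (smoothness is required within `Ω`). -/
def SOn (m n : ℕ) (α β : ℤ) (T : TMesh) : Set (ℝ × ℝ → ℝ) :=
  {f | PiecewisePoly m n T f ∧ SmoothWithin T.Omega α β f}

/-- The set of functions `S` is a linear space of dimension `d`. -/
def HasDim (S : Set (ℝ × ℝ → ℝ)) (d : ℕ) : Prop :=
  ∃ b : Fin d → (ℝ × ℝ → ℝ), (∀ i, b i ∈ S) ∧ LinearIndependent ℝ b ∧
    ∀ f ∈ S, ∃ c : Fin d → ℝ, f = ∑ i, c i • b i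

/-- The linear space `S` has dimension at least `d`. -/
def DimGE (S : Set (ℝ × ℝ → ℝ)) (d : ℕ) : Prop :=
  ∃ b : Fin d → (ℝ × ℝ → ℝ), (∀ i, b i ∈ S) ∧ LinearIndependent ℝ b

/-- The set of functions `S`, regarded as a space of functions on `Ω` (i.e. modulo the
values outside `Ω`), has dimension `d`. -/
def HasDimOn (Ω : Set (ℝ × ℝ)) (S : Set (ℝ × ℝ → ℝ)) (d : ℕ) : Prop :=
  ∃ b : Fin d → (ℝ × ℝ → ℝ), (∀ i, b i ∈ S) ∧
    LinearIndependent ℝ (fun i => Ω.restrict (b i)) ∧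
    ∀ f ∈ S, ∃ c : Fin d → ℝ, Set.EqOn f (∑ i, c i • b i) Ω

/-! The integration operator `I` and one-sided limits. -/

/-- `I(g)(x,y) = ∫_{-∞}^x ∫_{-∞}^y g(s,t) dt ds`. -/
def Ig (g : ℝ × ℝ → ℝ) : ℝ × ℝ → ℝ :=
  fun p => ∫ s in Set.Iic p.1, (∫ t in Set.Iic p.2, g (s, t))

/-- `g(s, y−)`, the one-sided limit from below in the second variable. -/
def limBelowY (g : ℝ × ℝ → ℝ) (y s : ℝ) : ℝ := limUnder (𝓝[<] y) fun t => g (s, t)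
/-- `g(s, y+)`. -/
def limAboveY (g : ℝ × ℝ → ℝ) (y s : ℝ) : ℝ := limUnder (𝓝[>] y) fun t => g (s, t)
/-- `g(x−, t)`. -/
def limLeftX (g : ℝ × ℝ → ℝ) (x t : ℝ) : ℝ := limUnder (𝓝[<] x) fun s => g (s, t)
/-- `g(x+, t)`. -/
def limRightX (g : ℝ × ℝ → ℝ) (x t : ℝ) : ℝ := limUnder (𝓝[>] x) fun s => g (s, t)

/-- The (cell-wise) partial derivative in `x`. -/
def pdX (f : ℝ × ℝ → ℝ) : ℝ × ℝ → ℝ := fun p => deriv (fun x => f (x, p.2)) p.1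
/-- The (cell-wise) partial derivative in `y`. -/
def pdY (f : ℝ × ℝ → ℝ) : ℝ × ℝ → ℝ := fun p => deriv (fun y => f (p.1, y)) p.2

/-- The union of the open interiors of the cells. -/
def cellInteriors (T : TMesh) : Set (ℝ × ℝ) := ⋃ c ∈ T.cells, interior c.toSet

open Classical in
/-- The cell-wise mixed partial derivative `∂²f/∂x∂y`, set to `0` off the cell interiors. -/
def Dmix (T : TMesh) (f : ℝ × ℝ → ℝ) : ℝ × ℝ → ℝ :=
  fun p => if p ∈ cellInteriors T then pdX (pdY f) p else 0

/-! Extended T-meshes. -/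

/-- The skeleton of a tensor-product mesh with grid lines `X 0 < ⋯ < X (2m+1)` and
`Y 0 < ⋯ < Y (2n+1)`. -/
def gridSkeleton (m n : ℕ) (X Y : ℕ → ℝ) : Set (ℝ × ℝ) :=
  {p : ℝ × ℝ | (∃ i ≤ 2 * m + 1, p.1 = X i) ∧ Y 0 ≤ p.2 ∧ p.2 ≤ Y (2 * n + 1)} ∪
  {p : ℝ × ℝ | (∃ j ≤ 2 * n + 1, p.2 = Y j) ∧ X 0 ≤ p.1 ∧ p.1 ≤ X (2 * m + 1)}

/-- The straight extensions, up to the rectangle `[x0,x1] × [y0,y1]`, of every l-edge of `T`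
having an endpoint on the boundary of the region of `T`. -/
def extSegs (T : TMesh) (x0 x1 y0 y1 : ℝ) : Set (ℝ × ℝ) :=
  {p : ℝ × ℝ | ∃ a b y, HorizLEdgeAt T a b y ∧ a = T.outer.xmin ∧
      p.2 = y ∧ x0 ≤ p.1 ∧ p.1 ≤ a} ∪
  {p : ℝ × ℝ | ∃ a b y, HorizLEdgeAt T a b y ∧ b = T.outer.xmax ∧
      p.2 = y ∧ b ≤ p.1 ∧ p.1 ≤ x1} ∪
  {p : ℝ × ℝ | ∃ x a b, a < b ∧ IsLEdge T (({x} : Set ℝ) ×ˢ Set.Icc a b) ∧ a = T.outer.ymin ∧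
      p.1 = x ∧ y0 ≤ p.2 ∧ p.2 ≤ a} ∪
  {p : ℝ × ℝ | ∃ x a b, a < b ∧ IsLEdge T (({x} : Set ℝ) ×ˢ Set.Icc a b) ∧ b = T.outer.ymax ∧
      p.1 = x ∧ b ≤ p.2 ∧ p.2 ≤ y1}

/-- `Te` is an extension of `T` associated with `S(m,n,m-1,n-1,T)`: a tensor-product mesh with
`2(m+1)` vertical and `2(n+1)` horizontal grid lines whose central rectangle is the region of
`T`, together with `T` and the straight extensions of all boundary-reaching edges of `T`. -/
def IsExtensionOf (m n : ℕ) (T Te : TMesh) : Prop :=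
  ∃ X Y : ℕ → ℝ,
    (∀ i < 2 * m + 1, X i < X (i + 1)) ∧ (∀ j < 2 * n + 1, Y j < Y (j + 1)) ∧
    X m = T.outer.xmin ∧ X (m + 1) = T.outer.xmax ∧
    Y n = T.outer.ymin ∧ Y (n + 1) = T.outer.ymax ∧
    Te.outer.xmin = X 0 ∧ Te.outer.xmax = X (2 * m + 1) ∧
    Te.outer.ymin = Y 0 ∧ Te.outer.ymax = Y (2 * n + 1) ∧
    Te.skeleton = T.skeleton ∪ gridSkeleton m n X Y ∪
      extSegs T (X 0) (X (2 * m + 1)) (Y 0) (Y (2 * n + 1))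

/-! Hierarchical T-meshes. -/

/-- `T` is a tensor-product mesh. -/
def IsTensorMesh (T : TMesh) : Prop :=
  ∃ (p q : ℕ) (x y : ℕ → ℝ), 0 < p ∧ 0 < q ∧
    (∀ i < p, x i < x (i + 1)) ∧ (∀ j < q, y j < y (j + 1)) ∧
    T.cells = {c : Rect | ∃ i < p, ∃ j < q,
      c.xmin = x i ∧ c.xmax = x (i + 1) ∧ c.ymin = y j ∧ c.ymax = y (j + 1)}

/-- The four equal subcells obtained by subdividing a cell by the two segments joining the
midpoints of opposite edges. -/
def Rect.quads (c : Rect) : Set Rect :=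
  { ⟨c.xmin, (c.xmin + c.xmax) / 2, c.ymin, (c.ymin + c.ymax) / 2,
      by linarith [c.hx], by linarith [c.hy]⟩,
    ⟨(c.xmin + c.xmax) / 2, c.xmax, c.ymin, (c.ymin + c.ymax) / 2,
      by linarith [c.hx], by linarith [c.hy]⟩,
    ⟨c.xmin, (c.xmin + c.xmax) / 2, (c.ymin + c.ymax) / 2, c.ymax,
      by linarith [c.hx], by linarith [c.hy]⟩,
    ⟨(c.xmin + c.xmax) / 2, c.xmax, (c.ymin + c.ymax) / 2, c.ymax,
      by linarith [c.hx], by linarith [c.hy]⟩ }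

/-- `T'` is obtained from `T` by subdividing exactly the cells in `S` into four quadrants. -/
def StepSubdiv (T T' : TMesh) (S : Set Rect) : Prop :=
  S ⊆ T.cells ∧ T'.outer = T.outer ∧
    T'.cells = (T.cells \ S) ∪ ⋃ c ∈ S, Rect.quads c

/-- A hierarchical T-mesh: the recursive construction `𝒯⁰, 𝒯¹, …, 𝒯^M`. -/
structure HierMesh where
  M : ℕ
  level : ℕ → TMesh
  subdivided : ℕ → Set Rect
  tensor0 : IsTensorMesh (level 0)
  step : ∀ k < M, StepSubdiv (level k) (level (k + 1)) (subdivided k)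

/-- The final mesh `𝒯 = 𝒯^M`. -/
def HierMesh.final (H : HierMesh) : TMesh := H.level H.M

/-- Two cells share a (horizontal or vertical) edge segment of positive length. -/
def EdgeAdjacent (c d : Rect) : Prop :=
  c ≠ d ∧ ∃ s : Set (ℝ × ℝ), (IsHorizSeg s ∨ IsVertSeg s) ∧ s ⊆ c.toSet ∩ d.toSet

/-- `c` is an isolated subdivided cell at step `k`: it is subdivided at step `k`, but no cell
of the level-`k` mesh sharing a horizontal or vertical edge with it is subdivided then. -/
def IsIsolatedAt (H : HierMesh) (k : ℕ) (c : Rect) : Prop :=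
  k < H.M ∧ c ∈ H.subdivided k ∧
    ∀ d ∈ (H.level k).cells, EdgeAdjacent c d → d ∉ H.subdivided k

/-- The isolated subdivided cells occurring in the construction of `H`. -/
def isoCells (H : HierMesh) : Set Rect := {c | ∃ k, IsIsolatedAt H k c}

/-- A regular T-mesh is crossing-vertex connected: any two distinct crossing vertices are
joined by a poly-line of axis-parallel mesh edges all of whose (corner) joints are crossing
vertices. -/
def IsCVConnected (T : TMesh) : Prop :=
  ∀ u v : ℝ × ℝ, IsCrossingVertex T u → IsCrossingVertex T v → u ≠ v →
    ∃ (N : ℕ) (p : ℕ → ℝ × ℝ), p 0 = u ∧ p N = v ∧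
      (∀ i < N, p i ≠ p (i + 1) ∧ segment ℝ (p i) (p (i + 1)) ⊆ T.skeleton ∧
        ((p i).1 = (p (i + 1)).1 ∨ (p i).2 = (p (i + 1)).2)) ∧
      (∀ i, 0 < i → i < N →
        (((p (i - 1)).2 = (p i).2 ∧ (p i).1 = (p (i + 1)).1) ∨
         ((p (i - 1)).1 = (p i).1 ∧ (p i).2 = (p (i + 1)).2)) →
        IsCrossingVertex T (p i))

/-- The level of an l-edge `s`: the first level of the hierarchy whose skeleton contains it. -/
def LEdgeLevel (H : HierMesh) (s : Set (ℝ × ℝ)) (k : ℕ) : Prop :=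
  s ⊆ (H.level k).skeleton ∧ ∀ j < k, ¬ s ⊆ (H.level j).skeleton

/-- `yb < yi < yt` are the heights of the two support l-edges of the horizontal l-edge
`[a,b] × {yi}` of the hierarchical mesh `H`: for a level-0 l-edge, the nearest level-0
horizontal l-edges below and above; for a level-`(k+1)` l-edge, the heights of the bottom
and top edges of a cell subdivided at step `k` whose inserted cross has its horizontal arm
on the l-edge. -/
def SupportHeights (H : HierMesh) (a b yi yb yt : ℝ) : Prop :=
  yb < yi ∧ yi < yt ∧
  ((LEdgeLevel H (Set.Icc a b ×ˢ ({yi} : Set ℝ)) 0 ∧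
     (∃ a' b', HorizLEdgeAt (H.level 0) a' b' yb) ∧
     (∃ a' b', HorizLEdgeAt (H.level 0) a' b' yt) ∧
     (∀ y a' b', HorizLEdgeAt (H.level 0) a' b' y → ¬(yb < y ∧ y < yt ∧ y ≠ yi))) ∨
   (∃ k, LEdgeLevel H (Set.Icc a b ×ˢ ({yi} : Set ℝ)) (k + 1) ∧
     ∃ c ∈ H.subdivided k, c.ymin = yb ∧ c.ymax = yt ∧ (c.ymin + c.ymax) / 2 = yi ∧
       a ≤ c.xmin ∧ c.xmax ≤ b))

/-- `U j` is a proper submesh of `U i` (its region is strictly contained in that of `U i`). -/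
def ProperSubmesh {ι : Type*} (U : ι → TMesh) (j i : ι) : Prop :=
  j ≠ i ∧ (U j).Omega ⊆ (U i).Omega ∧ (U j).Omega ≠ (U i).Omega

/-! The CVR graph. -/

/-- An edge of the CVR graph: a segment joining two consecutive crossing vertices along an
l-edge. -/
def IsCVREdge (T : TMesh) (s : Set (ℝ × ℝ)) : Prop :=
  ∃ u v : ℝ × ℝ, u ≠ v ∧ s = segment ℝ u v ∧ IsCrossingVertex T u ∧ IsCrossingVertex T v ∧
    (∃ l, IsLEdge T l ∧ segment ℝ u v ⊆ l) ∧
    ∀ w ∈ segment ℝ u v, IsCrossingVertex T w → w = u ∨ w = v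

/-- The union of the edges of the CVR graph, as a plane set. -/
def cvrGraphSet (T : TMesh) : Set (ℝ × ℝ) := ⋃₀ {s | IsCVREdge T s}

/-- The number of edges of the CVR graph. -/
def cvrEdgeCount (T : TMesh) : ℕ := {s | IsCVREdge T s}.ncard

/-- The number of bounded faces of the CVR graph: bounded connected components of the
complement of the union of its edges. -/
def cvrFaceCount (T : TMesh) : ℕ :=
  {U : Set (ℝ × ℝ) | (∃ p ∈ (cvrGraphSet T)ᶜ, U = connectedComponentIn (cvrGraphSet T)ᶜ p) ∧
     Bornology.IsBounded U}.ncard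

/-! ### Functions with continuous mixed first-order partial derivatives -/

/-- `f1`, `f2`, `f12` are the continuous partial derivatives `∂f/∂x`, `∂f/∂y` and
`∂²f/∂x∂y` of `f` within `S`, the last one being obtained in either order. -/
structure HasPartialsOn (S : Set (ℝ × ℝ)) (f f1 f2 f12 : ℝ × ℝ → ℝ) : Prop where
  cont : ContinuousOn f S
  cont1 : ContinuousOn f1 S
  cont2 : ContinuousOn f2 S
  cont12 : ContinuousOn f12 S
  dx : ∀ p ∈ S, HasDerivWithinAt (fun x => f (x, p.2)) (f1 p) {x | (x, p.2) ∈ S} p.1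
  dy : ∀ p ∈ S, HasDerivWithinAt (fun y => f (p.1, y)) (f2 p) {y | (p.1, y) ∈ S} p.2
  dxy : ∀ p ∈ S, HasDerivWithinAt (fun y => f1 (p.1, y)) (f12 p) {y | (p.1, y) ∈ S} p.2
  dyx : ∀ p ∈ S, HasDerivWithinAt (fun x => f2 (x, p.2)) (f12 p) {x | (x, p.2) ∈ S} p.1

lemma slice_left_prod {I J : Set ℝ} {y : ℝ} (hy : y ∈ J) : {x | (x, y) ∈ I ×ˢ J} = I := by
  ext x; simp [hy]

lemma slice_right_prod {I J : Set ℝ} {x : ℝ} (hx : x ∈ I) : {y | (x, y) ∈ I ×ˢ J} = J := by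
  ext y; simp [hx]

/-- A Lipschitz bound at a point of unique differentiability bounds the derivative. -/
lemma abs_derivWithin_le_of_bound {k : ℝ → ℝ} {k' C y₀ δ : ℝ} {J : Set ℝ}
    (hk : HasDerivWithinAt k k' J y₀) (hu : UniqueDiffWithinAt ℝ J y₀) (hδ : 0 < δ)
    (hb : ∀ y ∈ J, |y - y₀| < δ → |k y - k y₀| ≤ C * |y - y₀|) : |k'| ≤ C := by
  rw [hasDerivWithinAt_iff_tendsto_slope] at hk
  have hne : (𝓝[J \ {y₀}] y₀).NeBot := by
    rw [uniqueDiffWithinAt_iff_accPt, accPt_principal_iff_nhdsWithin] at hu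
    exact hu
  refine le_of_tendsto hk.abs ?_
  have h1 : ∀ᶠ y in 𝓝[J \ {y₀}] y₀, |y - y₀| < δ :=
    nhdsWithin_le_nhds (Metric.ball_mem_nhds y₀ hδ)
  filter_upwards [h1, self_mem_nhdsWithin] with y hy hyJ
  have hpos : 0 < |y - y₀| := abs_pos.2 (sub_ne_zero.2 hyJ.2)
  rw [slope_def_field, abs_div, div_le_iff₀ hpos]
  exact hb y hyJ.1 hy

/-- Symmetry of the mixed partial derivatives, when one of them is continuous. -/
lemma hasDerivWithinAt_mixed {I J : Set ℝ} (hI : Convex ℝ I) (hJ : Convex ℝ J)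
    (hu : UniqueDiffOn ℝ J) {f f1 f2 f12 : ℝ × ℝ → ℝ} (hc : ContinuousOn f12 (I ×ˢ J))
    (dx : ∀ x ∈ I, ∀ y ∈ J, HasDerivWithinAt (fun x => f (x, y)) (f1 (x, y)) I x)
    (dy : ∀ x ∈ I, ∀ y ∈ J, HasDerivWithinAt (fun y => f (x, y)) (f2 (x, y)) J y)
    (dxy : ∀ x ∈ I, ∀ y ∈ J, HasDerivWithinAt (fun y => f1 (x, y)) (f12 (x, y)) J y)
    {x₀ y₀ : ℝ} (hx₀ : x₀ ∈ I) (hy₀ : y₀ ∈ J) :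
    HasDerivWithinAt (fun x => f2 (x, y₀)) (f12 (x₀, y₀)) I x₀ := by
  set L := f12 (x₀, y₀) with hL
  rw [hasDerivWithinAt_iff_isLittleO, Asymptotics.isLittleO_iff]
  intro ε hε
  obtain ⟨δ, hδ, hδL⟩ := Metric.continuousOn_iff.1 hc (x₀, y₀) ⟨hx₀, hy₀⟩ ε hε
  have key : ∀ x ∈ I ∩ Metric.ball x₀ δ, ∀ y ∈ J ∩ Metric.ball y₀ δ, |f12 (x, y) - L| ≤ ε := by
    intro x hx y hy
    refine (hδL (x, y) ⟨hx.1, hy.1⟩ ?_).le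
    rw [Prod.dist_eq]
    exact max_lt hx.2 hy.2
  have hIδ : Convex ℝ (I ∩ Metric.ball x₀ δ) := hI.inter (convex_ball _ _)
  have hJδ : Convex ℝ (J ∩ Metric.ball y₀ δ) := hJ.inter (convex_ball _ _)
  have hx₀' : x₀ ∈ I ∩ Metric.ball x₀ δ := ⟨hx₀, Metric.mem_ball_self hδ⟩
  have hy₀' : y₀ ∈ J ∩ Metric.ball y₀ δ := ⟨hy₀, Metric.mem_ball_self hδ⟩
  have step1 : ∀ x ∈ I ∩ Metric.ball x₀ δ, ∀ y ∈ J ∩ Metric.ball y₀ δ,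
      |f1 (x, y) - f1 (x, y₀) - L * (y - y₀)| ≤ ε * |y - y₀| := by
    intro x hx y hy
    have := hJδ.norm_image_sub_le_of_norm_hasDerivWithin_le
      (f := fun y => f1 (x, y) - L * y) (f' := fun y => f12 (x, y) - L) (C := ε)
      (fun t ht => ((dxy x hx.1 t ht.1).mono inter_subset_left).sub
        (by simpa using ((hasDerivAt_id t).const_mul L).hasDerivWithinAt))
      (fun t ht => key x hx t ht) hy₀' hy
    rw [Real.norm_eq_abs, Real.norm_eq_abs] at this
    convert this using 2
    ring
  have step2 : ∀ x ∈ I ∩ Metric.ball x₀ δ, ∀ y ∈ J ∩ Metric.ball y₀ δ,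
      |f (x, y) - f (x, y₀) - (f (x₀, y) - f (x₀, y₀)) - L * (y - y₀) * (x - x₀)| ≤
        ε * |y - y₀| * |x - x₀| := by
    intro x hx y hy
    have := hIδ.norm_image_sub_le_of_norm_hasDerivWithin_le
      (f := fun x => f (x, y) - f (x, y₀) - L * (y - y₀) * x)
      (f' := fun x => f1 (x, y) - f1 (x, y₀) - L * (y - y₀)) (C := ε * |y - y₀|)
      (fun t ht => (((dx t ht.1 y hy.1).sub (dx t ht.1 y₀ hy₀)).mono inter_subset_left).sub
        (by simpa using ((hasDerivAt_id t).const_mul (L * (y - y₀))).hasDerivWithinAt))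
      (fun t ht => step1 t ht y hy) hx₀' hx
    rw [Real.norm_eq_abs, Real.norm_eq_abs] at this
    convert this using 2
    ring
  have hball : ∀ᶠ x in 𝓝[I] x₀, x ∈ I ∩ Metric.ball x₀ δ :=
    inter_mem self_mem_nhdsWithin (nhdsWithin_le_nhds (Metric.ball_mem_nhds x₀ hδ))
  filter_upwards [hball] with x hx
  rw [Real.norm_eq_abs, Real.norm_eq_abs, smul_eq_mul, mul_comm (x - x₀)]
  refine abs_derivWithin_le_of_bound (δ := δ) (y₀ := y₀) (J := J)
    (k := fun y => f (x, y) - f (x₀, y) - L * (x - x₀) * y) ?_ (hu y₀ hy₀) hδ ?_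
  · exact ((dy x hx.1 y₀ hy₀).sub (dy x₀ hx₀ y₀ hy₀)).sub
      (by simpa using ((hasDerivAt_id y₀).const_mul (L * (x - x₀))).hasDerivWithinAt)
  · intro y hy hyδ
    have := step2 x hx y ⟨hy, hyδ⟩
    rw [mul_right_comm ε] at this
    convert this using 2
    ring

namespace HasPartialsOn

variable {S S' : Set (ℝ × ℝ)} {f f1 f2 f12 g g1 g2 g12 : ℝ × ℝ → ℝ}

lemma mono (h : HasPartialsOn S f f1 f2 f12) (hS : S' ⊆ S) : HasPartialsOn S' f f1 f2 f12 where
  cont := h.cont.mono hS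
  cont1 := h.cont1.mono hS
  cont2 := h.cont2.mono hS
  cont12 := h.cont12.mono hS
  dx p hp := (h.dx p (hS hp)).mono fun _ hx => hS hx
  dy p hp := (h.dy p (hS hp)).mono fun _ hx => hS hx
  dxy p hp := (h.dxy p (hS hp)).mono fun _ hx => hS hx
  dyx p hp := (h.dyx p (hS hp)).mono fun _ hx => hS hx

lemma congr (h : HasPartialsOn S f f1 f2 f12) (e : EqOn g f S) (e1 : EqOn g1 f1 S)
    (e2 : EqOn g2 f2 S) (e12 : EqOn g12 f12 S) : HasPartialsOn S g g1 g2 g12 where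
  cont := h.cont.congr e
  cont1 := h.cont1.congr e1
  cont2 := h.cont2.congr e2
  cont12 := h.cont12.congr e12
  dx p hp := by rw [e1 hp]; exact (h.dx p hp).congr (fun _ hx => e hx) (e hp)
  dy p hp := by rw [e2 hp]; exact (h.dy p hp).congr (fun _ hx => e hx) (e hp)
  dxy p hp := by rw [e12 hp]; exact (h.dxy p hp).congr (fun _ hx => e1 hx) (e1 hp)
  dyx p hp := by rw [e12 hp]; exact (h.dyx p hp).congr (fun _ hx => e2 hx) (e2 hp)

lemma swap (h : HasPartialsOn S f f1 f2 f12) :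
    HasPartialsOn (Prod.swap ⁻¹' S) (f ∘ Prod.swap) (f2 ∘ Prod.swap) (f1 ∘ Prod.swap)
      (f12 ∘ Prod.swap) where
  cont := h.cont.comp continuous_swap.continuousOn (mapsTo_preimage _ _)
  cont1 := h.cont2.comp continuous_swap.continuousOn (mapsTo_preimage _ _)
  cont2 := h.cont1.comp continuous_swap.continuousOn (mapsTo_preimage _ _)
  cont12 := h.cont12.comp continuous_swap.continuousOn (mapsTo_preimage _ _)
  dx p hp := h.dy p.swap hp
  dy p hp := h.dx p.swap hp
  dxy p hp := h.dyx p.swap hp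
  dyx p hp := h.dxy p.swap hp

lemma add (hf : HasPartialsOn S f f1 f2 f12) (hg : HasPartialsOn S g g1 g2 g12) :
    HasPartialsOn S (f + g) (f1 + g1) (f2 + g2) (f12 + g12) where
  cont := hf.cont.add hg.cont
  cont1 := hf.cont1.add hg.cont1
  cont2 := hf.cont2.add hg.cont2
  cont12 := hf.cont12.add hg.cont12
  dx p hp := (hf.dx p hp).add (hg.dx p hp)
  dy p hp := (hf.dy p hp).add (hg.dy p hp)
  dxy p hp := (hf.dxy p hp).add (hg.dxy p hp)
  dyx p hp := (hf.dyx p hp).add (hg.dyx p hp)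

lemma const_smul (hf : HasPartialsOn S f f1 f2 f12) (a : ℝ) :
    HasPartialsOn S (a • f) (a • f1) (a • f2) (a • f12) where
  cont := hf.cont.const_smul a
  cont1 := hf.cont1.const_smul a
  cont2 := hf.cont2.const_smul a
  cont12 := hf.cont12.const_smul a
  dx p hp := (hf.dx p hp).const_mul a
  dy p hp := (hf.dy p hp).const_mul a
  dxy p hp := (hf.dxy p hp).const_mul a
  dyx p hp := (hf.dyx p hp).const_mul a

lemma zero : HasPartialsOn S 0 0 0 0 where
  cont := continuousOn_const
  cont1 := continuousOn_const
  cont2 := continuousOn_const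
  cont12 := continuousOn_const
  dx _ _ := hasDerivWithinAt_const _ _ _
  dy _ _ := hasDerivWithinAt_const _ _ _
  dxy _ _ := hasDerivWithinAt_const _ _ _
  dyx _ _ := hasDerivWithinAt_const _ _ _

lemma _root_.hasDerivWithinAt_union_of_isClosed {u : ℝ → ℝ} {u' x : ℝ} {s t : Set ℝ}
    (hs : IsClosed s) (ht : IsClosed t) (h1 : x ∈ s → HasDerivWithinAt u u' s x)
    (h2 : x ∈ t → HasDerivWithinAt u u' t x) : HasDerivWithinAt u u' (s ∪ t) x := by
  refine HasDerivWithinAt.union ?_ ?_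
  · by_cases hx : x ∈ s
    · exact h1 hx
    · exact HasFDerivWithinAt.of_notMem_closure (by rwa [hs.closure_eq])
  · by_cases hx : x ∈ t
    · exact h2 hx
    · exact HasFDerivWithinAt.of_notMem_closure (by rwa [ht.closure_eq])

lemma union (h : HasPartialsOn S f f1 f2 f12) (h' : HasPartialsOn S' f f1 f2 f12)
    (hS : IsClosed S) (hS' : IsClosed S') : HasPartialsOn (S ∪ S') f f1 f2 f12 where
  cont := h.cont.union_of_isClosed h'.cont hS hS'
  cont1 := h.cont1.union_of_isClosed h'.cont1 hS hS'
  cont2 := h.cont2.union_of_isClosed h'.cont2 hS hS'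
  cont12 := h.cont12.union_of_isClosed h'.cont12 hS hS'
  dx p _ := hasDerivWithinAt_union_of_isClosed
    (hS.preimage (f := fun x => (x, p.2)) (by fun_prop))
    (hS'.preimage (f := fun x => (x, p.2)) (by fun_prop)) (h.dx p) (h'.dx p)
  dy p _ := hasDerivWithinAt_union_of_isClosed
    (hS.preimage (f := fun y => (p.1, y)) (by fun_prop))
    (hS'.preimage (f := fun y => (p.1, y)) (by fun_prop)) (h.dy p) (h'.dy p)
  dxy p _ := hasDerivWithinAt_union_of_isClosed
    (hS.preimage (f := fun y => (p.1, y)) (by fun_prop))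
    (hS'.preimage (f := fun y => (p.1, y)) (by fun_prop)) (h.dxy p) (h'.dxy p)
  dyx p _ := hasDerivWithinAt_union_of_isClosed
    (hS.preimage (f := fun x => (x, p.2)) (by fun_prop))
    (hS'.preimage (f := fun x => (x, p.2)) (by fun_prop)) (h.dyx p) (h'.dyx p)

end HasPartialsOn

/-- On a product of nondegenerate intervals, `SmoothWithin _ 1 1` amounts to the existence of
continuous mixed partial derivatives. -/
lemma smoothWithin_one_one_iff {I J : Set ℝ} (hI : Convex ℝ I) (hJ : Convex ℝ J)
    (hIu : UniqueDiffOn ℝ I) (hJu : UniqueDiffOn ℝ J) (f : ℝ × ℝ → ℝ) :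
    SmoothWithin (I ×ˢ J) 1 1 f ↔ ∃ f1 f2 f12, HasPartialsOn (I ×ˢ J) f f1 f2 f12 := by
  constructor
  · rintro ⟨hc, hx, hxy⟩
    have dx := hx 0 (by norm_num)
    have dy := hxy 0 0 (by norm_num) (by norm_num)
    have dxy := hxy 1 0 (by norm_num) (by norm_num)
    refine ⟨mpW (I ×ˢ J) 1 0 f, mpW (I ×ˢ J) 0 1 f, mpW (I ×ˢ J) 1 1 f,
      hc 0 0 (by norm_num) (by norm_num), hc 1 0 (by norm_num) (by norm_num),
      hc 0 1 (by norm_num) (by norm_num), hc 1 1 (by norm_num) (by norm_num), dx, dy, dxy, ?_⟩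
    rintro ⟨x, y⟩ ⟨hx, hy⟩
    rw [slice_left_prod hy]
    refine hasDerivWithinAt_mixed (f := f) (f1 := mpW (I ×ˢ J) 1 0 f) hI hJ hJu
      (hc 1 1 (by norm_num) (by norm_num)) ?_ ?_ ?_ hx hy
    · intro x hx y hy
      have := dx (x, y) ⟨hx, hy⟩
      rwa [slice_left_prod hy] at this
    · intro x hx y hy
      have := dy (x, y) ⟨hx, hy⟩
      rwa [slice_right_prod hx] at this
    · intro x hx y hy
      have := dxy (x, y) ⟨hx, hy⟩
      rwa [slice_right_prod hx] at this
  · rintro ⟨f1, f2, f12, h⟩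
    have ux : ∀ p ∈ I ×ˢ J, UniqueDiffWithinAt ℝ {x | (x, p.2) ∈ I ×ˢ J} p.1 := by
      intro p hp
      rw [slice_left_prod hp.2]
      exact hIu _ hp.1
    have uy : ∀ p ∈ I ×ˢ J, UniqueDiffWithinAt ℝ {y | (p.1, y) ∈ I ×ˢ J} p.2 := by
      intro p hp
      rw [slice_right_prod hp.1]
      exact hJu _ hp.2
    have e1 : EqOn (pdXW (I ×ˢ J) f) f1 (I ×ˢ J) := fun p hp =>
      (h.dx p hp).derivWithin (ux p hp)
    have e2 : EqOn (pdYW (I ×ˢ J) f) f2 (I ×ˢ J) := fun p hp =>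
      (h.dy p hp).derivWithin (uy p hp)
    have d12 : ∀ p ∈ I ×ˢ J, HasDerivWithinAt (fun y => pdXW (I ×ˢ J) f (p.1, y)) (f12 p)
        {y | (p.1, y) ∈ I ×ˢ J} p.2 := fun p hp =>
      (h.dxy p hp).congr (fun y hy => e1 hy) (e1 hp)
    have e12 : EqOn (pdYW (I ×ˢ J) (pdXW (I ×ˢ J) f)) f12 (I ×ˢ J) := fun p hp =>
      (d12 p hp).derivWithin (uy p hp)
    refine ⟨fun i j hi hj => ?_, fun i hi p hp => ?_, fun i j hi hj p hp => ?_⟩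
    · obtain rfl | rfl : i = 0 ∨ i = 1 := by omega
      all_goals obtain rfl | rfl : j = 0 ∨ j = 1 := by omega
      · exact h.cont
      · exact h.cont2.congr e2
      · exact h.cont1.congr e1
      · exact h.cont12.congr e12
    · obtain rfl : i = 0 := by omega
      have := h.dx p hp
      rwa [← e1 hp] at this
    · obtain rfl : j = 0 := by omega
      obtain rfl | rfl : i = 0 ∨ i = 1 := by omega
      · have := h.dy p hp
        rwa [← e2 hp] at this
      · have := d12 p hp
        rwa [← e12 hp] at this

/-! ### Quadratic and biquadratic functions -/

/-- `u` agrees with a polynomial of degree at most `2` on `s`. -/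
def QuadOn (u : ℝ → ℝ) (s : Set ℝ) : Prop :=
  ∃ c : Fin 3 → ℝ, ∀ x ∈ s, u x = ∑ i, c i * x ^ (i : ℕ)

/-- `f` agrees with a polynomial of bidegree at most `(2, 2)` on `S`. -/
def BiquadOn (f : ℝ × ℝ → ℝ) (S : Set (ℝ × ℝ)) : Prop :=
  ∃ c : Fin 3 → Fin 3 → ℝ, ∀ q ∈ S, f q = ∑ i, ∑ j, c i j * q.1 ^ (i : ℕ) * q.2 ^ (j : ℕ)

lemma biquadOn_iff_exists_mvPolynomial {f : ℝ × ℝ → ℝ} {S : Set (ℝ × ℝ)} :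
    (∃ p : MvPolynomial (Fin 2) ℝ, p.degreeOf 0 ≤ 2 ∧ p.degreeOf 1 ≤ 2 ∧
      ∀ q ∈ S, f q = MvPolynomial.eval ![q.1, q.2] p) ↔ BiquadOn f S := by
  constructor
  · rintro ⟨p, h0, h1, hp⟩
    rw [MvPolynomial.degreeOf_le_iff] at h0 h1
    let e : Fin 3 × Fin 3 → (Fin 2 →₀ ℕ) := fun ij =>
      Finsupp.single 0 (ij.1 : ℕ) + Finsupp.single 1 (ij.2 : ℕ)
    have he0 : ∀ ij, e ij 0 = ij.1 := fun ij => by simp [e]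
    have he1 : ∀ ij, e ij 1 = ij.2 := fun ij => by simp [e]
    have hinj : Function.Injective e := fun a b hab => by
      ext
      · rw [← he0, ← he0, hab]
      · rw [← he1, ← he1, hab]
    refine ⟨fun i j => p.coeff (e (i, j)), fun q hq => ?_⟩
    rw [hp q hq, MvPolynomial.eval_eq', ← Finset.sum_product', Finset.univ_product_univ]
    have hsub : p.support ⊆ Finset.univ.image e := by
      intro d hd
      refine Finset.mem_image.2 ⟨(⟨d 0, by have := h0 d hd; omega⟩,
        ⟨d 1, by have := h1 d hd; omega⟩), Finset.mem_univ _, ?_⟩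
      ext k
      fin_cases k
      · exact he0 _
      · exact he1 _
    rw [Finset.sum_subset hsub, Finset.sum_image hinj.injOn]
    · refine Finset.sum_congr rfl fun ij _ => ?_
      rw [Fin.prod_univ_two, he0, he1]
      simp [mul_assoc]
    · intro d _ hd
      rw [MvPolynomial.notMem_support_iff.1 hd, zero_mul]
  · rintro ⟨c, hc⟩
    refine ⟨∑ i : Fin 3, ∑ j : Fin 3, MvPolynomial.C (c i j) * MvPolynomial.X 0 ^ (i : ℕ) *
      MvPolynomial.X 1 ^ (j : ℕ), ?_, ?_, fun q hq => ?_⟩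
    · refine (MvPolynomial.degreeOf_sum_le _ _ _).trans (Finset.sup_le fun i _ => ?_)
      refine (MvPolynomial.degreeOf_sum_le _ _ _).trans (Finset.sup_le fun j _ => ?_)
      refine (MvPolynomial.degreeOf_mul_le _ _ _).trans ?_
      have h1 := (MvPolynomial.degreeOf_C_mul_le (MvPolynomial.X 0 ^ (i : ℕ) :
        MvPolynomial (Fin 2) ℝ) 0 (c i j)).trans (MvPolynomial.degreeOf_pow_le _ _ _)
      have h2 := MvPolynomial.degreeOf_pow_le (0 : Fin 2)
        (MvPolynomial.X 1 : MvPolynomial (Fin 2) ℝ) j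
      rw [MvPolynomial.degreeOf_X] at h1 h2
      simp at h1 h2
      omega
    · refine (MvPolynomial.degreeOf_sum_le _ _ _).trans (Finset.sup_le fun i _ => ?_)
      refine (MvPolynomial.degreeOf_sum_le _ _ _).trans (Finset.sup_le fun j _ => ?_)
      refine (MvPolynomial.degreeOf_mul_le _ _ _).trans ?_
      have h1 := (MvPolynomial.degreeOf_C_mul_le (MvPolynomial.X 0 ^ (i : ℕ) :
        MvPolynomial (Fin 2) ℝ) 1 (c i j)).trans (MvPolynomial.degreeOf_pow_le _ _ _)
      have h2 := MvPolynomial.degreeOf_pow_le (1 : Fin 2)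
        (MvPolynomial.X 1 : MvPolynomial (Fin 2) ℝ) j
      rw [MvPolynomial.degreeOf_X] at h1 h2
      rw [if_neg (by decide), mul_zero] at h1
      rw [if_pos rfl, mul_one] at h2
      omega
    · rw [hc q hq]
      simp [map_sum]

lemma piecewisePoly_two_two_iff {T : TMesh} {f : ℝ × ℝ → ℝ} :
    PiecewisePoly 2 2 T f ↔ ∀ c ∈ T.cells, BiquadOn f c.toSet :=
  forall₂_congr fun _ _ => biquadOn_iff_exists_mvPolynomial

namespace BiquadOn

variable {f g : ℝ × ℝ → ℝ} {S S' : Set (ℝ × ℝ)}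

lemma mono (h : BiquadOn f S) (hS : S' ⊆ S) : BiquadOn f S' :=
  let ⟨c, hc⟩ := h
  ⟨c, fun q hq => hc q (hS hq)⟩

lemma congr (h : BiquadOn f S) (e : EqOn g f S) : BiquadOn g S :=
  let ⟨c, hc⟩ := h
  ⟨c, fun q hq => (e hq).trans (hc q hq)⟩

lemma add (hf : BiquadOn f S) (hg : BiquadOn g S) : BiquadOn (f + g) S := by
  obtain ⟨c, hc⟩ := hf
  obtain ⟨d, hd⟩ := hg
  refine ⟨c + d, fun q hq => ?_⟩
  simp [hc q hq, hd q hq, add_mul, Finset.sum_add_distrib]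

lemma const_smul (hf : BiquadOn f S) (a : ℝ) : BiquadOn (a • f) S := by
  obtain ⟨c, hc⟩ := hf
  refine ⟨a • c, fun q hq => ?_⟩
  simp [hc q hq, Finset.mul_sum, mul_assoc]

lemma zero : BiquadOn 0 S := ⟨0, fun q _ => by simp⟩

lemma swap (h : BiquadOn f S) : BiquadOn (f ∘ Prod.swap) (Prod.swap ⁻¹' S) := by
  obtain ⟨c, hc⟩ := h
  refine ⟨fun i j => c j i, fun q hq => ?_⟩
  rw [Function.comp_apply, hc _ hq, Finset.sum_comm]
  simp [mul_right_comm]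

lemma quadOn_snd {I J : Set ℝ} (h : BiquadOn f (I ×ˢ J)) {x : ℝ} (hx : x ∈ I) :
    QuadOn (fun y => f (x, y)) J := by
  obtain ⟨c, hc⟩ := h
  refine ⟨fun j => ∑ i, c i j * x ^ (i : ℕ), fun y hy => ?_⟩
  simp only [hc (x, y) ⟨hx, hy⟩, Finset.sum_mul]
  exact Finset.sum_comm

lemma quadOn_fst {I J : Set ℝ} (h : BiquadOn f (I ×ˢ J)) {y : ℝ} (hy : y ∈ J) :
    QuadOn (fun x => f (x, y)) I := by
  obtain ⟨c, hc⟩ := h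
  refine ⟨fun i => ∑ j, c i j * y ^ (j : ℕ), fun x hx => ?_⟩
  simp only [hc (x, y) ⟨hx, hy⟩, Finset.sum_mul]
  exact Finset.sum_congr rfl fun i _ => Finset.sum_congr rfl fun j _ => by ring

/-- The normal derivative of a biquadratic function along a vertical line is quadratic. -/
lemma quadOn_snd_deriv {a b : ℝ} {J : Set ℝ} {f1 : ℝ × ℝ → ℝ} (hab : a < b)
    (h : BiquadOn f (Icc a b ×ˢ J)) {x : ℝ} (hx : x ∈ Icc a b)
    (hd : ∀ y ∈ J, HasDerivWithinAt (fun x => f (x, y)) (f1 (x, y)) (Icc a b) x) :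
    QuadOn (fun y => f1 (x, y)) J := by
  obtain ⟨c, hc⟩ := h
  refine ⟨fun j => c 1 j + 2 * c 2 j * x, fun y hy => ?_⟩
  refine (uniqueDiffOn_Icc hab x hx).eq_deriv _ (hd y hy) ?_
  have hpoly : ∀ t ∈ Icc a b, f (t, y) = (∑ j : Fin 3, c 0 j * y ^ (j : ℕ)) +
      (∑ j : Fin 3, c 1 j * y ^ (j : ℕ)) * t + (∑ j : Fin 3, c 2 j * y ^ (j : ℕ)) * t ^ 2 := by
    intro t ht
    rw [hc (t, y) ⟨ht, hy⟩, Fin.sum_univ_three]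
    simp [Finset.sum_mul, mul_right_comm]
  refine HasDerivWithinAt.congr ?_ hpoly (hpoly x hx)
  refine HasDerivAt.hasDerivWithinAt ?_
  have := (((hasDerivAt_id x).const_mul (∑ j : Fin 3, c 1 j * y ^ (j : ℕ))).const_add
    (∑ j : Fin 3, c 0 j * y ^ (j : ℕ))).add
      (((hasDerivAt_id x).pow 2).const_mul (∑ j : Fin 3, c 2 j * y ^ (j : ℕ)))
  refine this.congr_deriv ?_
  simp only [Fin.sum_univ_three, id]
  simp
  ring

end BiquadOn

lemma QuadOn.mono {u : ℝ → ℝ} {s t : Set ℝ} (h : QuadOn u s) (hst : t ⊆ s) : QuadOn u t :=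
  let ⟨c, hc⟩ := h
  ⟨c, fun x hx => hc x (hst hx)⟩

lemma QuadOn.biquadOn_mul {u v : ℝ → ℝ} {s t : Set ℝ} (hu : QuadOn u s) (hv : QuadOn v t) :
    BiquadOn (fun z => u z.1 * v z.2) (s ×ˢ t) := by
  obtain ⟨c, hc⟩ := hu
  obtain ⟨d, hd⟩ := hv
  refine ⟨fun i j => c i * d j, fun q hq => ?_⟩
  simp only [hc _ hq.1, hd _ hq.2, Finset.sum_mul_sum]
  exact Finset.sum_congr rfl fun i _ => Finset.sum_congr rfl fun j _ => by ring

/-! ### One-dimensional extension by splines -/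

lemma hasDerivAt_max_zero_sub_sq (k x : ℝ) :
    HasDerivAt (fun x => max 0 (x - k) ^ 2) (2 * max 0 (x - k)) x := by
  rw [← hasDerivWithinAt_univ, ← Iic_union_Ici (a := k)]
  refine hasDerivWithinAt_union_of_isClosed isClosed_Iic isClosed_Ici (fun hx => ?_) fun hx => ?_
  · have h0 : ∀ t ∈ Iic k, max 0 (t - k) = 0 := fun t ht => max_eq_left (sub_nonpos.2 ht)
    rw [h0 x hx, mul_zero]
    exact (hasDerivWithinAt_const x (Iic k) (0 : ℝ)).congr
      (fun t ht => by rw [h0 t ht]; norm_num) (by rw [h0 x hx]; norm_num)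
  · have h0 : ∀ t ∈ Ici k, max 0 (t - k) = t - k := fun t ht => max_eq_right (sub_nonneg.2 ht)
    have hd : HasDerivAt (fun t => (t - k) ^ 2) (2 * (x - k)) x := by
      exact (((hasDerivAt_id x).sub_const k).pow 2).congr_deriv (by simp)
    rw [h0 x hx]
    exact hd.hasDerivWithinAt.congr (fun t ht => by rw [h0 t ht]) (by rw [h0 x hx])

/-- A `C¹` quadratic spline with knots `a < b < p`, vanishing to the left of `a`, with given
value and derivative at `p`. -/
lemma exists_spline_left {a b p : ℝ} (hab : a < b) (hbp : b < p) (v w : ℝ) :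
    ∃ A A' : ℝ → ℝ, (∀ x, HasDerivAt A (A' x) x) ∧ Continuous A' ∧ A p = v ∧ A' p = w ∧
      (∀ x ≤ a, A x = 0) ∧ QuadOn A (Icc a b) ∧ QuadOn A (Icc b p) := by
  have h1 : b - a ≠ 0 := (sub_pos.2 hab).ne'
  have h2 : p - b ≠ 0 := (sub_pos.2 hbp).ne'
  have h3 : p - a ≠ 0 := (sub_pos.2 (hab.trans hbp)).ne'
  obtain ⟨α, β, hv, hw⟩ : ∃ α β : ℝ, α * (p - a) ^ 2 + β * (p - b) ^ 2 = v ∧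
      α * (2 * (p - a)) + β * (2 * (p - b)) = w := by
    refine ⟨(v * 2 - w * (p - b)) / (2 * (p - a) * (b - a)),
      (w * (p - a) - v * 2) / (2 * (p - b) * (b - a)), ?_, ?_⟩ <;>
    · field_simp
      ring
  refine ⟨fun x => α * max 0 (x - a) ^ 2 + β * max 0 (x - b) ^ 2,
    fun x => α * (2 * max 0 (x - a)) + β * (2 * max 0 (x - b)),
    fun x => ((hasDerivAt_max_zero_sub_sq a x).const_mul α).add
      ((hasDerivAt_max_zero_sub_sq b x).const_mul β), by fun_prop, ?_, ?_, fun x hx => ?_,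
    ⟨![α * a ^ 2, -2 * α * a, α], fun x hx => ?_⟩,
    ⟨![α * a ^ 2 + β * b ^ 2, -2 * α * a - 2 * β * b, α + β], fun x hx => ?_⟩⟩
  · simp only [max_eq_right (sub_pos.2 hbp).le, max_eq_right (sub_pos.2 (hab.trans hbp)).le, hv]
  · simp only [max_eq_right (sub_pos.2 hbp).le, max_eq_right (sub_pos.2 (hab.trans hbp)).le, hw]
  · simp only [max_eq_left (sub_nonpos.2 hx), max_eq_left (sub_nonpos.2 (hx.trans hab.le))]
    ring
  · simp only [max_eq_right (sub_nonneg.2 hx.1), max_eq_left (sub_nonpos.2 hx.2),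
      Fin.sum_univ_three]
    simp
    ring
  · simp only [max_eq_right (sub_nonneg.2 hx.1),
      max_eq_right (sub_nonneg.2 (hab.le.trans hx.1)), Fin.sum_univ_three]
    simp
    ring

lemma QuadOn.comp_neg {u : ℝ → ℝ} {a b : ℝ} (h : QuadOn u (Icc a b)) :
    QuadOn (fun x => u (-x)) (Icc (-b) (-a)) := by
  obtain ⟨c, hc⟩ := h
  refine ⟨![c 0, -c 1, c 2], fun x hx => ?_⟩
  simp only [hc (-x) ⟨by linarith [hx.2], by linarith [hx.1]⟩, Fin.sum_univ_three]
  simp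

/-- The mirror image of `exists_spline_left`. -/
lemma exists_spline_right {q b a : ℝ} (hqb : q < b) (hba : b < a) (v w : ℝ) :
    ∃ A A' : ℝ → ℝ, (∀ x, HasDerivAt A (A' x) x) ∧ Continuous A' ∧ A q = v ∧ A' q = w ∧
      (∀ x, a ≤ x → A x = 0) ∧ QuadOn A (Icc q b) ∧ QuadOn A (Icc b a) := by
  obtain ⟨A, A', hA, hc, hv, hw, h0, hq1, hq2⟩ :=
    exists_spline_left (neg_lt_neg hba) (neg_lt_neg hqb) v (-w)
  refine ⟨fun x => A (-x), fun x => -A' (-x), fun x => ?_, by fun_prop, hv, by simp [hw],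
    fun x hx => h0 _ (neg_le_neg hx), by simpa using hq2.comp_neg, by simpa using hq1.comp_neg⟩
  exact ((hA (-x)).scomp x (hasDerivAt_neg x)).congr_deriv (by simp)

lemma hasPartialsOn_mul {A A' u u' : ℝ → ℝ} {J : Set ℝ} (hA : ∀ x, HasDerivAt A (A' x) x)
    (hA' : Continuous A') (hu : ∀ y ∈ J, HasDerivWithinAt u (u' y) J y)
    (hu' : ContinuousOn u' J) :
    HasPartialsOn (univ ×ˢ J) (fun z => A z.1 * u z.2) (fun z => A' z.1 * u z.2)
      (fun z => A z.1 * u' z.2) (fun z => A' z.1 * u' z.2) := by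
  have cA : Continuous A := continuous_iff_continuousAt.2 fun x => (hA x).continuousAt
  have cu : ContinuousOn u J := fun y hy => (hu y hy).continuousWithinAt
  have c1 : ∀ {v : ℝ → ℝ}, Continuous v → ContinuousOn (fun z : ℝ × ℝ => v z.1) (univ ×ˢ J) :=
    fun hv => (hv.comp continuous_fst).continuousOn
  have c2 : ∀ {v : ℝ → ℝ}, ContinuousOn v J →
      ContinuousOn (fun z : ℝ × ℝ => v z.2) (univ ×ˢ J) :=
    fun hv => hv.comp continuous_snd.continuousOn fun z hz => hz.2
  refine ⟨(c1 cA).mul (c2 cu), (c1 hA').mul (c2 cu), (c1 cA).mul (c2 hu'),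
    (c1 hA').mul (c2 hu'), ?_, ?_, ?_, ?_⟩
  · exact fun p _ => (hA p.1).hasDerivWithinAt.mul_const (u p.2)
  · rintro ⟨x, y⟩ ⟨hx, hy⟩
    rw [slice_right_prod hx]
    exact (hu y hy).const_mul (A x)
  · rintro ⟨x, y⟩ ⟨hx, hy⟩
    rw [slice_right_prod hx]
    exact (hu y hy).const_mul (A' x)
  · exact fun p _ => (hA p.1).hasDerivWithinAt.mul_const (u' p.2)

/-- The point of `[p, q]` closest to `x`. -/
def clampTo (p q x : ℝ) : ℝ := max p (min x q)

lemma clampTo_mem {p q : ℝ} (hpq : p ≤ q) (x : ℝ) : clampTo p q x ∈ Icc p q :=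
  ⟨le_max_left _ _, max_le hpq (min_le_right _ _)⟩

lemma clampTo_of_le {p q x : ℝ} (hx : x ≤ p) : clampTo p q x = p :=
  max_eq_left ((min_le_left _ _).trans hx)

lemma clampTo_of_ge {p q x : ℝ} (hpq : p ≤ q) (hx : q ≤ x) : clampTo p q x = q := by
  rw [clampTo, min_eq_right hx, max_eq_right hpq]

lemma clampTo_of_mem {p q x : ℝ} (hx : x ∈ Icc p q) : clampTo p q x = x := by
  rw [clampTo, min_eq_left hx.2, max_eq_right hx.1]

/-- A function on the plane glued from `l` on `x < p`, `g` on `p ≤ x ≤ q` and `r` on `q < x`. -/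
def glueFst (p q : ℝ) (l g r : ℝ × ℝ → ℝ) (z : ℝ × ℝ) : ℝ :=
  if z.1 < p then l z else if q < z.1 then r z else g z

lemma glueFst_of_mem {p q : ℝ} {l g r : ℝ × ℝ → ℝ} {z : ℝ × ℝ} (hz : z.1 ∈ Icc p q) :
    glueFst p q l g r z = g z := by
  rw [glueFst, if_neg hz.1.not_gt, if_neg hz.2.not_gt]

lemma glueFst_of_le {p q : ℝ} (hpq : p ≤ q) {l g r : ℝ × ℝ → ℝ} {z : ℝ × ℝ}
    (h : ∀ y, l (p, y) = g (p, y)) (hz : z.1 ≤ p) : glueFst p q l g r z = l z := by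
  obtain hlt | heq := hz.lt_or_eq
  · rw [glueFst, if_pos hlt]
  · obtain ⟨x, y⟩ := z
    obtain rfl : x = p := heq
    rw [glueFst_of_mem (z := (x, y)) ⟨le_rfl, hpq⟩, h]

lemma glueFst_of_ge {p q : ℝ} (hpq : p ≤ q) {l g r : ℝ × ℝ → ℝ} {z : ℝ × ℝ}
    (h : ∀ y, r (q, y) = g (q, y)) (hz : q ≤ z.1) : glueFst p q l g r z = r z := by
  obtain hlt | heq := hz.lt_or_eq
  · rw [glueFst, if_neg (hpq.trans hz).not_gt, if_pos hlt]
  · obtain ⟨x, y⟩ := z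
    obtain rfl : q = x := heq
    rw [glueFst_of_mem (z := (q, y)) ⟨hpq, le_rfl⟩, h]

lemma HasPartialsOn.glueFst {p q : ℝ} (hpq : p ≤ q) {J : Set ℝ} (hJ : IsClosed J)
    {l l1 l2 l12 g g1 g2 g12 r r1 r2 r12 : ℝ × ℝ → ℝ}
    (hl : HasPartialsOn (univ ×ˢ J) l l1 l2 l12) (hg : HasPartialsOn (Icc p q ×ˢ J) g g1 g2 g12)
    (hr : HasPartialsOn (univ ×ˢ J) r r1 r2 r12)
    (e : ∀ y, l (p, y) = g (p, y)) (e1 : ∀ y, l1 (p, y) = g1 (p, y))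
    (e2 : ∀ y, l2 (p, y) = g2 (p, y)) (e12 : ∀ y, l12 (p, y) = g12 (p, y))
    (e' : ∀ y, r (q, y) = g (q, y)) (e1' : ∀ y, r1 (q, y) = g1 (q, y))
    (e2' : ∀ y, r2 (q, y) = g2 (q, y)) (e12' : ∀ y, r12 (q, y) = g12 (q, y)) :
    HasPartialsOn (univ ×ˢ J) (glueFst p q l g r) (glueFst p q l1 g1 r1) (glueFst p q l2 g2 r2)
      (glueFst p q l12 g12 r12) := by
  have hcov : (univ : Set ℝ) = (Iic p ∪ Icc p q) ∪ Ici q := by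
    rw [Iic_union_Icc_eq_Iic hpq, Iic_union_Ici]
  rw [hcov, union_prod, union_prod]
  refine HasPartialsOn.union (HasPartialsOn.union ?_ ?_ (isClosed_Iic.prod hJ)
    (isClosed_Icc.prod hJ)) ?_ ((isClosed_Iic.prod hJ).union (isClosed_Icc.prod hJ))
    (isClosed_Ici.prod hJ)
  · exact (hl.mono (prod_mono_left (subset_univ _))).congr
      (fun z hz => glueFst_of_le hpq e hz.1) (fun z hz => glueFst_of_le hpq e1 hz.1)
      (fun z hz => glueFst_of_le hpq e2 hz.1) (fun z hz => glueFst_of_le hpq e12 hz.1)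
  · exact hg.congr (fun z hz => glueFst_of_mem hz.1) (fun z hz => glueFst_of_mem hz.1)
      (fun z hz => glueFst_of_mem hz.1) (fun z hz => glueFst_of_mem hz.1)
  · exact (hr.mono (prod_mono_left (subset_univ _))).congr
      (fun z hz => glueFst_of_ge hpq e' hz.1) (fun z hz => glueFst_of_ge hpq e1' hz.1)
      (fun z hz => glueFst_of_ge hpq e2' hz.1) (fun z hz => glueFst_of_ge hpq e12' hz.1)

/-- Extension of a `C¹` function in the first variable by quadratic splines with knots
`X 0, X 1, X 2` on the left and `X 3, X 4, X 5` on the right. The last clause says that the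
extension is biquadratic on a rectangle as soon as the original function is biquadratic on a
rectangle containing its projection. -/
lemma exists_extension_fst {X : ℕ → ℝ} (hX : ∀ i < 5, X i < X (i + 1)) {J : Set ℝ}
    (hJ : IsClosed J) {f f1 f2 f12 : ℝ × ℝ → ℝ}
    (hf : HasPartialsOn (Icc (X 2) (X 3) ×ˢ J) f f1 f2 f12) :
    ∃ F F1 F2 F12, HasPartialsOn (univ ×ˢ J) F F1 F2 F12 ∧
      (∀ x ∈ Icc (X 2) (X 3), ∀ y, F (x, y) = f (x, y)) ∧
      (∀ x y, x ≤ X 0 ∨ X 5 ≤ x → F (x, y) = 0 ∧ F2 (x, y) = 0) ∧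
      (∀ y, (∀ x ∈ Icc (X 2) (X 3), f (x, y) = 0 ∧ f1 (x, y) = 0) → ∀ x, F (x, y) = 0) ∧
      ∀ i < 5, ∀ a b : ℝ, a ≤ b → Icc a b ⊆ Icc (X i) (X (i + 1)) → ∀ a' b' : ℝ, a' < b' →
        Icc a' b' ⊆ Icc (X 2) (X 3) → ∀ K ⊆ J, clampTo (X 2) (X 3) a ∈ Icc a' b' →
        clampTo (X 2) (X 3) b ∈ Icc a' b' → BiquadOn f (Icc a' b' ×ˢ K) →
        BiquadOn F (Icc a b ×ˢ K) := by
  have h01 : X 0 < X 1 := hX 0 (by norm_num)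
  have h12 : X 1 < X 2 := hX 1 (by norm_num)
  have h23 : X 2 < X 3 := hX 2 (by norm_num)
  have h34 : X 3 < X 4 := hX 3 (by norm_num)
  have h45 : X 4 < X 5 := hX 4 (by norm_num)
  obtain ⟨A, A', hA, hA', hAv, hAw, hA0, hAq, hAq'⟩ := exists_spline_left h01 h12 1 0
  obtain ⟨B, B', hB, hB', hBv, hBw, hB0, hBq, hBq'⟩ := exists_spline_left h01 h12 0 1
  obtain ⟨C, C', hC, hC', hCv, hCw, hC0, hCq, hCq'⟩ := exists_spline_right h34 h45 1 0
  obtain ⟨D, D', hD, hD', hDv, hDw, hD0, hDq, hDq'⟩ := exists_spline_right h34 h45 0 1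
  have hp : X 2 ∈ Icc (X 2) (X 3) := ⟨le_rfl, h23.le⟩
  have hq : X 3 ∈ Icc (X 2) (X 3) := ⟨h23.le, le_rfl⟩
  have dy : ∀ x ∈ Icc (X 2) (X 3), ∀ y ∈ J,
      HasDerivWithinAt (fun y => f (x, y)) (f2 (x, y)) J y := fun x hx y hy => by
    have := hf.dy (x, y) ⟨hx, hy⟩
    rwa [slice_right_prod hx] at this
  have dxy : ∀ x ∈ Icc (X 2) (X 3), ∀ y ∈ J,
      HasDerivWithinAt (fun y => f1 (x, y)) (f12 (x, y)) J y := fun x hx y hy => by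
    have := hf.dxy (x, y) ⟨hx, hy⟩
    rwa [slice_right_prod hx] at this
  have c2 : ∀ x ∈ Icc (X 2) (X 3), ContinuousOn (fun y => f2 (x, y)) J := fun x hx =>
    hf.cont2.comp (by fun_prop) fun y hy => ⟨hx, hy⟩
  have c12 : ∀ x ∈ Icc (X 2) (X 3), ContinuousOn (fun y => f12 (x, y)) J := fun x hx =>
    hf.cont12.comp (by fun_prop) fun y hy => ⟨hx, hy⟩
  have hL := (hasPartialsOn_mul hA hA' (dy _ hp) (c2 _ hp)).add
    (hasPartialsOn_mul hB hB' (dxy _ hp) (c12 _ hp))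
  have hR := (hasPartialsOn_mul hC hC' (dy _ hq) (c2 _ hq)).add
    (hasPartialsOn_mul hD hD' (dxy _ hq) (c12 _ hq))
  refine ⟨_, _, _, _, HasPartialsOn.glueFst h23.le hJ hL hf hR ?_ ?_ ?_ ?_ ?_ ?_ ?_ ?_,
    fun x hx y => glueFst_of_mem hx, ?_, ?_, ?_⟩
  iterate 4 · intro y; simp [hAv, hAw, hBv, hBw]
  iterate 4 · intro y; simp [hCv, hCw, hDv, hDw]
  · rintro x y (hx | hx)
    · have hx2 : x < X 2 := by linarith
      simp [_root_.glueFst, hx2, hA0 x hx, hB0 x hx]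
    · have hx2 : ¬ x < X 2 := by linarith
      have hx3 : X 3 < x := by linarith
      simp [_root_.glueFst, hx2, hx3, hC0 x hx, hD0 x hx]
  · intro y hy x
    simp only [_root_.glueFst]
    split_ifs with h h'
    · simp [hy _ hp]
    · simp [hy _ hq]
    · exact (hy x ⟨not_lt.1 h, not_lt.1 h'⟩).1
  · intro i hi a b hab hsub a' b' hab' hsub' K hK ha hb hfq
    have hd : ∀ x ∈ Icc a' b', ∀ y ∈ K,
        HasDerivWithinAt (fun x => f (x, y)) (f1 (x, y)) (Icc a' b') x := fun x hx y hy => by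
      have := hf.dx (x, y) ⟨hsub' hx, hK hy⟩
      rw [slice_left_prod (hK hy)] at this
      exact this.mono hsub'
    obtain hi2 | rfl | hi2 : i < 2 ∨ i = 2 ∨ 2 < i := by omega
    · have hle : ∀ x ∈ Icc a b, x ≤ X 2 := fun x hx => (hsub hx).2.trans (by
        interval_cases i
        · exact h12.le
        · exact le_rfl)
      rw [clampTo_of_le (hle a ⟨le_rfl, hab⟩)] at ha
      have hAi : QuadOn A (Icc a b) ∧ QuadOn B (Icc a b) := by
        interval_cases i
        · exact ⟨hAq.mono hsub, hBq.mono hsub⟩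
        · exact ⟨hAq'.mono hsub, hBq'.mono hsub⟩
      refine ((hAi.1.biquadOn_mul (hfq.quadOn_snd ha)).add
        (hAi.2.biquadOn_mul (hfq.quadOn_snd_deriv hab' ha (hd _ ha)))).congr fun z hz => ?_
      refine glueFst_of_le h23.le (fun y => ?_) (hle _ hz.1)
      simp [hAv, hBv]
    · rw [clampTo_of_mem (hsub ⟨le_rfl, hab⟩)] at ha
      rw [clampTo_of_mem (hsub ⟨hab, le_rfl⟩)] at hb
      exact (hfq.mono (prod_mono_left (Icc_subset_Icc ha.1 hb.2))).congr
        fun z hz => glueFst_of_mem (hsub hz.1)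
    · have hle : ∀ x ∈ Icc a b, X 3 ≤ x := fun x hx => le_trans (by
        interval_cases i
        · exact le_rfl
        · exact h34.le) (hsub hx).1
      rw [clampTo_of_ge h23.le (hle a ⟨le_rfl, hab⟩)] at ha
      have hAi : QuadOn C (Icc a b) ∧ QuadOn D (Icc a b) := by
        interval_cases i
        · exact ⟨hCq.mono hsub, hDq.mono hsub⟩
        · exact ⟨hCq'.mono hsub, hDq'.mono hsub⟩
      refine ((hAi.1.biquadOn_mul (hfq.quadOn_snd ha)).add
        (hAi.2.biquadOn_mul (hfq.quadOn_snd_deriv hab' ha (hd _ ha)))).congr fun z hz => ?_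
      refine glueFst_of_ge h23.le (fun y => ?_) (hle _ hz.1)
      simp [hCv, hDv]

/-! ### Geometry of the mesh and of its extension -/

lemma Rect.mem_toSet {c : Rect} {z : ℝ × ℝ} :
    z ∈ c.toSet ↔ z.1 ∈ Icc c.xmin c.xmax ∧ z.2 ∈ Icc c.ymin c.ymax := Iff.rfl

lemma Rect.isClosed_toSet (c : Rect) : IsClosed c.toSet := isClosed_Icc.prod isClosed_Icc

lemma Rect.interior_toSet (c : Rect) :
    interior c.toSet = Ioo c.xmin c.xmax ×ˢ Ioo c.ymin c.ymax := by
  rw [Rect.toSet, interior_prod_eq, interior_Icc, interior_Icc]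

lemma Rect.closure_interior_toSet (c : Rect) : closure (interior c.toSet) = c.toSet := by
  rw [Rect.interior_toSet, closure_prod_eq, closure_Ioo c.hx.ne, closure_Ioo c.hy.ne, Rect.toSet]

lemma Rect.mem_frontier_toSet {c : Rect} {z : ℝ × ℝ} : z ∈ frontier c.toSet ↔ z ∈ c.toSet ∧
    ((z.1 = c.xmin ∨ z.1 = c.xmax) ∨ (z.2 = c.ymin ∨ z.2 = c.ymax)) := by
  rw [c.isClosed_toSet.frontier_eq, Rect.interior_toSet, Rect.toSet]
  simp only [Set.mem_sdiff, mem_prod, mem_Icc, mem_Ioo]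
  grind

namespace TMesh

variable {T : TMesh} {c : Rect}

lemma toSet_subset_outer (hc : c ∈ T.cells) : c.toSet ⊆ T.outer.toSet := by
  rw [← T.union_eq]
  exact subset_biUnion_of_mem (u := fun c : Rect => c.toSet) hc

lemma cell_bounds (hc : c ∈ T.cells) : T.outer.xmin ≤ c.xmin ∧ c.xmax ≤ T.outer.xmax ∧
    T.outer.ymin ≤ c.ymin ∧ c.ymax ≤ T.outer.ymax := by
  have h1 := toSet_subset_outer hc (a := (c.xmin, c.ymin)) ⟨⟨le_rfl, c.hx.le⟩, le_rfl, c.hy.le⟩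
  have h2 := toSet_subset_outer hc (a := (c.xmax, c.ymax)) ⟨⟨c.hx.le, le_rfl⟩, c.hy.le, le_rfl⟩
  exact ⟨h1.1.1, h2.1.2, h1.2.1, h2.2.2⟩

lemma exists_cell {z : ℝ × ℝ} (hz : z ∈ T.outer.toSet) : ∃ c ∈ T.cells, z ∈ c.toSet := by
  rw [← T.union_eq] at hz
  simpa using hz

lemma mem_skeleton {z : ℝ × ℝ} : z ∈ T.skeleton ↔ ∃ c ∈ T.cells, z ∈ frontier c.toSet := by
  simp [skeleton]

lemma isClosed_skeleton (T : TMesh) : IsClosed T.skeleton :=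
  T.finite_cells.isClosed_biUnion fun _ _ => isClosed_frontier

lemma skeleton_subset (T : TMesh) : T.skeleton ⊆ T.outer.toSet := by
  intro z hz
  obtain ⟨c, hc, hz⟩ := mem_skeleton.1 hz
  exact toSet_subset_outer hc (Rect.mem_frontier_toSet.1 hz).1

lemma notMem_skeleton_of_mem_interior (hc : c ∈ T.cells) {z : ℝ × ℝ}
    (hz : z ∈ interior c.toSet) : z ∉ T.skeleton := by
  intro hs
  obtain ⟨d, hd, hzd⟩ := mem_skeleton.1 hs
  by_cases hcd : c = d
  · subst hcd
    exact hzd.2 hz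
  · have hcl : z ∈ closure (interior d.toSet) := by
      rw [d.closure_interior_toSet]
      exact (Rect.mem_frontier_toSet.1 hzd).1
    obtain ⟨w, hw, hw'⟩ := mem_closure_iff.1 hcl _ isOpen_interior hz
    exact disjoint_left.1 (T.pairwise_disjoint hc hd hcd) hw hw'

/-- The heights of the horizontal edges of the cells. -/
def heights (T : TMesh) : Set ℝ := ⋃ c ∈ T.cells, {c.ymin, c.ymax}

/-- The abscissae of the vertical edges of the cells. -/
def abscissae (T : TMesh) : Set ℝ := ⋃ c ∈ T.cells, {c.xmin, c.xmax}

lemma finite_heights (T : TMesh) : T.heights.Finite :=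
  T.finite_cells.biUnion fun _ _ => toFinite _

lemma finite_abscissae (T : TMesh) : T.abscissae.Finite :=
  T.finite_cells.biUnion fun _ _ => toFinite _

lemma mem_of_mem_skeleton {z : ℝ × ℝ} (hz : z ∈ T.skeleton) :
    z.1 ∈ T.abscissae ∨ z.2 ∈ T.heights := by
  obtain ⟨c, hc, hz⟩ := mem_skeleton.1 hz
  refine (Rect.mem_frontier_toSet.1 hz).2.imp (fun h => ?_) fun h => ?_
  · exact mem_biUnion hc (by simpa using h)
  · exact mem_biUnion hc (by simpa using h)

lemma mem_heights_of_subset_skeleton {a b y : ℝ} (hab : a < b)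
    (h : Icc a b ×ˢ ({y} : Set ℝ) ⊆ T.skeleton) : y ∈ T.heights := by
  by_contra hy
  exact (Icc_infinite hab) (T.finite_abscissae.subset fun x hx =>
    (mem_of_mem_skeleton (h (a := (x, y)) ⟨hx, rfl⟩)).resolve_right hy)

lemma mem_abscissae_of_subset_skeleton {x a b : ℝ} (hab : a < b)
    (h : ({x} : Set ℝ) ×ˢ Icc a b ⊆ T.skeleton) : x ∈ T.abscissae := by
  by_contra hx
  exact (Icc_infinite hab) (T.finite_heights.subset fun y hy =>
    (mem_of_mem_skeleton (h (a := (x, y)) ⟨rfl, hy⟩)).resolve_left hx)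

end TMesh

/-- A nondegenerate interval inside a closed bounded set is contained in a maximal one. -/
lemma exists_maximal_Icc {K : Set ℝ} (hK : IsClosed K) {p q : ℝ} (hpq : K ⊆ Icc p q) {a₀ b₀ : ℝ}
    (h₀ : a₀ ≤ b₀) (hs : Icc a₀ b₀ ⊆ K) :
    ∃ a b, a ≤ a₀ ∧ b₀ ≤ b ∧ Icc a b ⊆ K ∧
      ∀ a' b', a' ≤ a → b ≤ b' → Icc a' b' ⊆ K → a' = a ∧ b' = b := by
  have hKc : IsCompact K := isCompact_Icc.of_isClosed_subset hK hpq
  set C := connectedComponentIn K a₀ with hC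
  have ha₀ : a₀ ∈ K := hs ⟨le_rfl, h₀⟩
  have hCK : C ⊆ K := connectedComponentIn_subset K a₀
  have hCc : IsCompact C := by
    refine hKc.of_isClosed_subset ?_ hCK
    refine isClosed_of_closure_subset ?_
    exact isPreconnected_connectedComponentIn.closure.subset_connectedComponentIn
      (subset_closure (mem_connectedComponentIn ha₀)) (closure_minimal hCK hK)
  have hconn : IsConnected C := isConnected_connectedComponentIn_iff.2 ha₀
  have hCI : C = Icc (sInf C) (sSup C) := eq_Icc_of_connected_compact hconn hCc
  have hsub : ∀ a b, a ≤ a₀ → a₀ ≤ b → Icc a b ⊆ K → Icc a b ⊆ C := fun a b ha hb h =>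
    isPreconnected_Icc.subset_connectedComponentIn ⟨ha, hb⟩ h
  have h1 := hsub a₀ b₀ le_rfl h₀ hs
  have ha1 : a₀ ∈ Icc (sInf C) (sSup C) := hCI ▸ h1 ⟨le_rfl, h₀⟩
  have hb1 : b₀ ∈ Icc (sInf C) (sSup C) := hCI ▸ h1 ⟨h₀, le_rfl⟩
  refine ⟨sInf C, sSup C, ha1.1, hb1.2, hCI ▸ hCK, fun a' b' ha' hb' h => ?_⟩
  have ha2 : a' ≤ a₀ := ha'.trans ha1.1
  have hb2 : a₀ ≤ b' := ha1.2.trans hb'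
  have h2 := hsub a' b' ha2 hb2 h
  have ha3 : a' ∈ Icc (sInf C) (sSup C) := hCI ▸ h2 ⟨le_rfl, ha2.trans hb2⟩
  have hb3 : b' ∈ Icc (sInf C) (sSup C) := hCI ▸ h2 ⟨ha2.trans hb2, le_rfl⟩
  exact ⟨le_antisymm ha' ha3.1, le_antisymm hb3.2 hb'⟩

lemma exists_horizLEdgeAt {T : TMesh} {a₀ b₀ y : ℝ} (h₀ : a₀ < b₀)
    (hs : Icc a₀ b₀ ×ˢ ({y} : Set ℝ) ⊆ T.skeleton) :
    ∃ a b, T.outer.xmin ≤ a ∧ a ≤ a₀ ∧ b₀ ≤ b ∧ b ≤ T.outer.xmax ∧ HorizLEdgeAt T a b y := by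
  have hK : IsClosed {x | (x, y) ∈ T.skeleton} :=
    T.isClosed_skeleton.preimage (f := fun x => (x, y)) (by fun_prop)
  have hKI : {x | (x, y) ∈ T.skeleton} ⊆ Icc T.outer.xmin T.outer.xmax :=
    fun x hx => (T.skeleton_subset hx).1
  obtain ⟨a, b, ha, hb, hab, hmax⟩ := exists_maximal_Icc hK hKI h₀.le fun x hx => hs ⟨hx, rfl⟩
  have hlt : a < b := by linarith
  refine ⟨a, b, (hKI (hab ⟨le_rfl, hlt.le⟩)).1, ha, hb, (hKI (hab ⟨hlt.le, le_rfl⟩)).2, hlt,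
    Or.inl ⟨a, b, y, hlt, rfl⟩, ?_, ?_⟩
  · rintro ⟨x, y'⟩ ⟨hx, rfl⟩
    exact hab hx
  · rintro s' (⟨a', b', y', -, rfl⟩ | ⟨x', a', b', -, rfl⟩) hs' hsub
    · have h1 := hsub (a := (a, y)) ⟨⟨le_rfl, hlt.le⟩, rfl⟩
      have h2 := hsub (a := (b, y)) ⟨⟨hlt.le, le_rfl⟩, rfl⟩
      obtain rfl : y = y' := h1.2
      obtain ⟨rfl, rfl⟩ := hmax a' b' h1.1.1 h2.1.2 fun x hx => hs' ⟨hx, rfl⟩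
      rfl
    · have h1 : a = x' := (hsub (a := (a, y)) ⟨⟨le_rfl, hlt.le⟩, rfl⟩).1
      have h2 : b = x' := (hsub (a := (b, y)) ⟨⟨hlt.le, le_rfl⟩, rfl⟩).1
      exact absurd (h1.trans h2.symm) hlt.ne

lemma exists_vertLEdge {T : TMesh} {x a₀ b₀ : ℝ} (h₀ : a₀ < b₀)
    (hs : ({x} : Set ℝ) ×ˢ Icc a₀ b₀ ⊆ T.skeleton) :
    ∃ a b, T.outer.ymin ≤ a ∧ a ≤ a₀ ∧ b₀ ≤ b ∧ b ≤ T.outer.ymax ∧ a < b ∧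
      IsLEdge T (({x} : Set ℝ) ×ˢ Icc a b) := by
  have hK : IsClosed {y | (x, y) ∈ T.skeleton} :=
    T.isClosed_skeleton.preimage (f := fun y => (x, y)) (by fun_prop)
  have hKI : {y | (x, y) ∈ T.skeleton} ⊆ Icc T.outer.ymin T.outer.ymax :=
    fun y hy => (T.skeleton_subset hy).2
  obtain ⟨a, b, ha, hb, hab, hmax⟩ := exists_maximal_Icc hK hKI h₀.le fun y hy => hs ⟨rfl, hy⟩
  have hlt : a < b := by linarith
  refine ⟨a, b, (hKI (hab ⟨le_rfl, hlt.le⟩)).1, ha, hb, (hKI (hab ⟨hlt.le, le_rfl⟩)).2, hlt,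
    Or.inr ⟨x, a, b, hlt, rfl⟩, ?_, ?_⟩
  · rintro ⟨x', y⟩ ⟨rfl, hy⟩
    exact hab hy
  · rintro s' (⟨a', b', y', -, rfl⟩ | ⟨x', a', b', -, rfl⟩) hs' hsub
    · have h1 : a = y' := (hsub (a := (x, a)) ⟨rfl, ⟨le_rfl, hlt.le⟩⟩).2
      have h2 : b = y' := (hsub (a := (x, b)) ⟨rfl, ⟨hlt.le, le_rfl⟩⟩).2
      exact absurd (h1.trans h2.symm) hlt.ne
    · have h1 := hsub (a := (x, a)) ⟨rfl, ⟨le_rfl, hlt.le⟩⟩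
      have h2 := hsub (a := (x, b)) ⟨rfl, ⟨hlt.le, le_rfl⟩⟩
      obtain rfl : x = x' := h1.1
      obtain ⟨rfl, rfl⟩ := hmax a' b' h1.2.1 h2.2.2 fun y hy => hs' ⟨rfl, hy⟩
      rfl

/-- Extended horizontal cell edges belong to the extended skeleton. -/
lemma mem_extension_of_horizontal {T : TMesh} {x0 x1 y0 y1 : ℝ} {d : Rect} (hd : d ∈ T.cells)
    {x e : ℝ} (he : e = d.ymin ∨ e = d.ymax) (hx : x ∈ Icc x0 x1)
    (hxd : clampTo T.outer.xmin T.outer.xmax x ∈ Icc d.xmin d.xmax) :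
    (x, e) ∈ T.skeleton ∪ extSegs T x0 x1 y0 y1 := by
  have hsk : Icc d.xmin d.xmax ×ˢ ({e} : Set ℝ) ⊆ T.skeleton := by
    rintro ⟨t, e'⟩ ⟨ht, rfl⟩
    refine TMesh.mem_skeleton.2 ⟨d, hd, Rect.mem_frontier_toSet.2 ⟨⟨ht, ?_⟩, Or.inr he⟩⟩
    obtain rfl | rfl := he
    · exact ⟨le_rfl, d.hy.le⟩
    · exact ⟨d.hy.le, le_rfl⟩
  obtain ⟨a, b, h1, h2, h3, h4, hL⟩ := exists_horizLEdgeAt d.hx hsk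
  by_cases hl : x < T.outer.xmin
  · rw [clampTo_of_le hl.le] at hxd
    have ha : a = T.outer.xmin := le_antisymm (h2.trans hxd.1) h1
    exact Or.inr (Or.inl (Or.inl (Or.inl ⟨a, b, e, hL, ha, rfl, hx.1, ha ▸ hl.le⟩)))
  by_cases hr : T.outer.xmax < x
  · rw [clampTo_of_ge T.outer.hx.le hr.le] at hxd
    have hb : b = T.outer.xmax := le_antisymm h4 (hxd.2.trans h3)
    exact Or.inr (Or.inl (Or.inl (Or.inr ⟨a, b, e, hL, hb, rfl, hb ▸ hr.le, hx.2⟩)))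
  · rw [clampTo_of_mem ⟨not_lt.1 hl, not_lt.1 hr⟩] at hxd
    exact Or.inl (hsk ⟨hxd, rfl⟩)

/-- Extended vertical cell edges belong to the extended skeleton. -/
lemma mem_extension_of_vertical {T : TMesh} {x0 x1 y0 y1 : ℝ} {d : Rect} (hd : d ∈ T.cells)
    {e y : ℝ} (he : e = d.xmin ∨ e = d.xmax) (hy : y ∈ Icc y0 y1)
    (hyd : clampTo T.outer.ymin T.outer.ymax y ∈ Icc d.ymin d.ymax) :
    (e, y) ∈ T.skeleton ∪ extSegs T x0 x1 y0 y1 := by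
  have hsk : ({e} : Set ℝ) ×ˢ Icc d.ymin d.ymax ⊆ T.skeleton := by
    rintro ⟨e', t⟩ ⟨rfl, ht⟩
    refine TMesh.mem_skeleton.2 ⟨d, hd, Rect.mem_frontier_toSet.2 ⟨⟨?_, ht⟩, Or.inl he⟩⟩
    obtain rfl | rfl := he
    · exact ⟨le_rfl, d.hx.le⟩
    · exact ⟨d.hx.le, le_rfl⟩
  obtain ⟨a, b, h1, h2, h3, h4, hab, hL⟩ := exists_vertLEdge d.hy hsk
  by_cases hl : y < T.outer.ymin
  · rw [clampTo_of_le hl.le] at hyd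
    have ha : a = T.outer.ymin := le_antisymm (h2.trans hyd.1) h1
    exact Or.inr (Or.inl (Or.inr ⟨e, a, b, hab, hL, ha, rfl, hy.1, ha ▸ hl.le⟩))
  by_cases hr : T.outer.ymax < y
  · rw [clampTo_of_ge T.outer.hy.le hr.le] at hyd
    have hb : b = T.outer.ymax := le_antisymm h4 (hyd.2.trans h3)
    exact Or.inr (Or.inr ⟨e, a, b, hab, hL, hb, rfl, hb ▸ hr.le, hy.2⟩)
  · rw [clampTo_of_mem ⟨not_lt.1 hl, not_lt.1 hr⟩] at hyd
    exact Or.inl (hsk ⟨rfl, hyd⟩)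

lemma clampTo_mem_of_no_knot {p q a b m d₁ d₂ : ℝ} (hp : p ≤ d₁) (hq : d₂ ≤ q) (hd : d₁ ≤ d₂)
    (hm : m ∈ Ioo a b) (hmd : clampTo p q m ∈ Icc d₁ d₂) (h₁ : d₁ ∉ Ioo a b)
    (h₂ : d₂ ∉ Ioo a b) : clampTo p q a ∈ Icc d₁ d₂ ∧ clampTo p q b ∈ Icc d₁ d₂ := by
  simp only [clampTo, mem_Icc, mem_Ioo, not_and, not_lt] at *
  grind

/-! ### Comparison of the cells of a mesh and of its extension -/

lemma TMesh.heights_subset (T : TMesh) : T.heights ⊆ Icc T.outer.ymin T.outer.ymax := by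
  intro y hy
  simp only [TMesh.heights, mem_iUnion, mem_insert_iff, mem_singleton_iff] at hy
  obtain ⟨c, hc, hy⟩ := hy
  have := T.cell_bounds hc
  have := c.hy
  constructor <;> grind

lemma TMesh.abscissae_subset (T : TMesh) : T.abscissae ⊆ Icc T.outer.xmin T.outer.xmax := by
  intro x hx
  simp only [TMesh.abscissae, mem_iUnion, mem_insert_iff, mem_singleton_iff] at hx
  obtain ⟨c, hc, hx⟩ := hx
  have := T.cell_bounds hc
  have := c.hx
  constructor <;> grind

lemma extSegs_cases {T : TMesh} {x0 x1 y0 y1 : ℝ} {z : ℝ × ℝ} (hz : z ∈ extSegs T x0 x1 y0 y1) :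
    (z.2 ∈ T.heights ∧ z.1 ∉ Ioo T.outer.xmin T.outer.xmax) ∨
      (z.1 ∈ T.abscissae ∧ z.2 ∉ Ioo T.outer.ymin T.outer.ymax) := by
  rcases hz with ((⟨a, b, y, ⟨hab, hL⟩, h, rfl, -, h1⟩ | ⟨a, b, y, ⟨hab, hL⟩, h, rfl, h1, -⟩) |
    ⟨x, a, b, hab, hL, h, rfl, -, h1⟩) | ⟨x, a, b, hab, hL, h, rfl, h1, -⟩
  · exact Or.inl ⟨T.mem_heights_of_subset_skeleton hab hL.2.1, fun h' => by linarith [h'.1]⟩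
  · exact Or.inl ⟨T.mem_heights_of_subset_skeleton hab hL.2.1, fun h' => by linarith [h'.2]⟩
  · exact Or.inr ⟨T.mem_abscissae_of_subset_skeleton hab hL.2.1, fun h' => by linarith [h'.1]⟩
  · exact Or.inr ⟨T.mem_abscissae_of_subset_skeleton hab hL.2.1, fun h' => by linarith [h'.2]⟩

/-- `Te` is the extension of `T` with grid lines `X` and `Y`. -/
structure IsGridExtension (T Te : TMesh) (X Y : ℕ → ℝ) : Prop where
  hX : ∀ i < 5, X i < X (i + 1)
  hY : ∀ j < 5, Y j < Y (j + 1)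
  xmin : X 2 = T.outer.xmin
  xmax : X 3 = T.outer.xmax
  ymin : Y 2 = T.outer.ymin
  ymax : Y 3 = T.outer.ymax
  xmin' : Te.outer.xmin = X 0
  xmax' : Te.outer.xmax = X 5
  ymin' : Te.outer.ymin = Y 0
  ymax' : Te.outer.ymax = Y 5
  skeleton : Te.skeleton = T.skeleton ∪ gridSkeleton 2 2 X Y ∪ extSegs T (X 0) (X 5) (Y 0) (Y 5)

lemma IsExtensionOf.exists_isGridExtension {T Te : TMesh} (h : IsExtensionOf 2 2 T Te) :
    ∃ X Y, IsGridExtension T Te X Y :=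
  let ⟨X, Y, h1, h2, h3, h4, h5, h6, h7, h8, h9, h10, h11⟩ := h
  ⟨X, Y, h1, h2, h3, h4, h5, h6, h7, h8, h9, h10, h11⟩

section Grid

variable {X : ℕ → ℝ}

lemma grid_le (hX : ∀ i < 5, X i < X (i + 1)) {i j : ℕ} (hij : i ≤ j) (hj : j ≤ 5) : X i ≤ X j := by
  induction j, hij using Nat.le_induction with
  | base => exact le_rfl
  | succ j _ ih => exact (ih (by omega)).trans (hX j (by omega)).le

lemma grid_notMem_Ioo (hX : ∀ i < 5, X i < X (i + 1)) {i k : ℕ} (hi : i < 5) (hk : k ≤ 5) :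
    X k ∉ Ioo (X i) (X (i + 1)) := by
  rintro ⟨h1, h2⟩
  rcases Nat.lt_or_ge i k with h | h
  · exact h2.not_ge (grid_le hX h hk)
  · exact h1.not_ge (grid_le hX h (by omega))

lemma disjoint_Ioo_grid_middle (hX : ∀ i < 5, X i < X (i + 1)) {i : ℕ} (hi : i < 5) (hi2 : i ≠ 2)
    {x : ℝ} (hx : x ∈ Ioo (X i) (X (i + 1))) : x ∉ Icc (X 2) (X 3) := by
  rintro ⟨h1, h2⟩
  rcases Nat.lt_or_ge i 2 with h | h
  · linarith [hx.2, grid_le hX (show i + 1 ≤ 2 by omega) (by omega)]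
  · linarith [hx.1, grid_le hX (show 3 ≤ i by omega) (by omega)]

lemma exists_grid_Icc {a b : ℝ} (h0 : X 0 ≤ a) (h5 : b ≤ X 5) (hab : a < b)
    (h : ∀ k ≤ 5, X k ∉ Ioo a b) : ∃ i < 5, Icc a b ⊆ Icc (X i) (X (i + 1)) := by
  by_contra! hno
  have key : ∀ k ≤ 5, X k ≤ a := by
    intro k
    induction k with
    | zero => exact fun _ => h0
    | succ k ih =>
      intro hk
      have hXk := ih (by omega)
      by_contra! hlt
      refine hno k (by omega) (Icc_subset_Icc hXk ?_)
      by_contra! hb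
      exact h (k + 1) hk ⟨hlt, hb⟩
  linarith [key 5 le_rfl]

end Grid

namespace IsGridExtension

variable {T Te : TMesh} {X Y : ℕ → ℝ} {c : Rect}

lemma clampTo_mem_cell (h : IsGridExtension T Te X Y) (hc : c ∈ Te.cells) :
    ∃ d ∈ T.cells, clampTo (X 2) (X 3) c.xmin ∈ Icc d.xmin d.xmax ∧
      clampTo (X 2) (X 3) c.xmax ∈ Icc d.xmin d.xmax ∧
      clampTo (Y 2) (Y 3) c.ymin ∈ Icc d.ymin d.ymax ∧
      clampTo (Y 2) (Y 3) c.ymax ∈ Icc d.ymin d.ymax := by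
  have hcx := c.hx
  have hcy := c.hy
  obtain ⟨b1, b2, b3, b4⟩ := Te.cell_bounds hc
  rw [h.xmin'] at b1
  rw [h.xmax'] at b2
  rw [h.ymin'] at b3
  rw [h.ymax'] at b4
  obtain ⟨mx, hmx⟩ : (Ioo c.xmin c.xmax).Nonempty := nonempty_Ioo.2 hcx
  obtain ⟨my, hmy⟩ : (Ioo c.ymin c.ymax).Nonempty := nonempty_Ioo.2 hcy
  obtain ⟨d, hd, hdx, hdy⟩ := T.exists_cell (z := (clampTo (X 2) (X 3) mx, clampTo (Y 2) (Y 3) my))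
    ⟨by rw [← h.xmin, ← h.xmax]; exact clampTo_mem (h.hX 2 (by norm_num)).le _,
      by rw [← h.ymin, ← h.ymax]; exact clampTo_mem (h.hY 2 (by norm_num)).le _⟩
  obtain ⟨d1, d2, d3, d4⟩ := T.cell_bounds hd
  rw [← h.xmin] at d1
  rw [← h.xmax] at d2
  rw [← h.ymin] at d3
  rw [← h.ymax] at d4
  have hno : ∀ z ∈ interior c.toSet,
      z ∉ T.skeleton ∪ extSegs T (X 0) (X 5) (Y 0) (Y 5) := fun z hz hz' => by
    refine Te.notMem_skeleton_of_mem_interior hc hz ?_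
    rw [h.skeleton]
    exact hz'.imp_left Or.inl
  rw [Rect.interior_toSet] at hno
  have hv : ∀ e, e = d.xmin ∨ e = d.xmax → e ∉ Ioo c.xmin c.xmax := fun e he hmem =>
    hno (e, my) ⟨hmem, hmy⟩ (mem_extension_of_vertical hd he
      ⟨b3.trans hmy.1.le, hmy.2.le.trans b4⟩ (by rwa [← h.ymin, ← h.ymax]))
  have hh : ∀ e, e = d.ymin ∨ e = d.ymax → e ∉ Ioo c.ymin c.ymax := fun e he hmem =>
    hno (mx, e) ⟨hmx, hmem⟩ (mem_extension_of_horizontal hd he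
      ⟨b1.trans hmx.1.le, hmx.2.le.trans b2⟩ (by rwa [← h.xmin, ← h.xmax]))
  obtain ⟨hx1, hx2⟩ := clampTo_mem_of_no_knot d1 d2 d.hx.le hmx hdx
    (hv _ (Or.inl rfl)) (hv _ (Or.inr rfl))
  obtain ⟨hy1, hy2⟩ := clampTo_mem_of_no_knot d3 d4 d.hy.le hmy hdy
    (hh _ (Or.inl rfl)) (hh _ (Or.inr rfl))
  exact ⟨d, hd, hx1, hx2, hy1, hy2⟩

lemma exists_grid_Icc_fst (h : IsGridExtension T Te X Y) (hc : c ∈ Te.cells) :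
    ∃ i < 5, Icc c.xmin c.xmax ⊆ Icc (X i) (X (i + 1)) := by
  obtain ⟨b1, b2, b3, b4⟩ := Te.cell_bounds hc
  rw [h.ymin'] at b3
  rw [h.ymax'] at b4
  obtain ⟨y, hy⟩ : (Ioo c.ymin c.ymax).Nonempty := nonempty_Ioo.2 c.hy
  refine exists_grid_Icc (h.xmin' ▸ b1) (h.xmax' ▸ b2) c.hx fun k hk hmem => ?_
  refine Te.notMem_skeleton_of_mem_interior hc (z := (X k, y))
    (by rw [Rect.interior_toSet]; exact ⟨hmem, hy⟩) ?_
  rw [h.skeleton]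
  exact Or.inl (Or.inr (Or.inl ⟨⟨k, hk, rfl⟩, b3.trans hy.1.le, hy.2.le.trans b4⟩))

lemma exists_grid_Icc_snd (h : IsGridExtension T Te X Y) (hc : c ∈ Te.cells) :
    ∃ j < 5, Icc c.ymin c.ymax ⊆ Icc (Y j) (Y (j + 1)) := by
  obtain ⟨b1, b2, b3, b4⟩ := Te.cell_bounds hc
  rw [h.xmin'] at b1
  rw [h.xmax'] at b2
  obtain ⟨x, hx⟩ : (Ioo c.xmin c.xmax).Nonempty := nonempty_Ioo.2 c.hx
  refine exists_grid_Icc (h.ymin' ▸ b3) (h.ymax' ▸ b4) c.hy fun k hk hmem => ?_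
  refine Te.notMem_skeleton_of_mem_interior hc (z := (x, Y k))
    (by rw [Rect.interior_toSet]; exact ⟨hx, hmem⟩) ?_
  rw [h.skeleton]
  exact Or.inl (Or.inr (Or.inr ⟨⟨k, hk, rfl⟩, b1.trans hx.1.le, hx.2.le.trans b2⟩))

lemma outer_subset (h : IsGridExtension T Te X Y) : T.outer.toSet ⊆ Te.outer.toSet := by
  rw [Rect.toSet, Rect.toSet, h.xmin', h.xmax', h.ymin', h.ymax', ← h.xmin, ← h.xmax, ← h.ymin,
    ← h.ymax]
  exact prod_mono
    (Icc_subset_Icc (grid_le h.hX (by norm_num) (by norm_num))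
      (grid_le h.hX (by norm_num) (by norm_num)))
    (Icc_subset_Icc (grid_le h.hY (by norm_num) (by norm_num))
      (grid_le h.hY (by norm_num) (by norm_num)))

lemma notMem_skeleton_of_mem_interior (h : IsGridExtension T Te X Y) (hc : c ∈ T.cells)
    {z : ℝ × ℝ} (hz : z ∈ interior c.toSet) : z ∉ Te.skeleton := by
  have hz1 : z ∈ Ioo (X 2) (X 3) ×ˢ Ioo (Y 2) (Y 3) := by
    have := interior_mono (T.toSet_subset_outer hc) hz
    rwa [Rect.interior_toSet, ← h.xmin, ← h.xmax, ← h.ymin, ← h.ymax] at this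
  rw [h.skeleton]
  rintro ((hs | ⟨⟨k, hk, hzk⟩, -⟩ | ⟨⟨k, hk, hzk⟩, -⟩) | hs)
  · exact T.notMem_skeleton_of_mem_interior hc hz hs
  · exact grid_notMem_Ioo h.hX (i := 2) (by norm_num) hk (hzk ▸ hz1.1)
  · exact grid_notMem_Ioo h.hY (i := 2) (by norm_num) hk (hzk ▸ hz1.2)
  · rw [h.xmin, h.xmax, h.ymin, h.ymax] at hz1
    rcases extSegs_cases hs with ⟨-, h'⟩ | ⟨-, h'⟩
    · exact h' hz1.1
    · exact h' hz1.2

/-- The extension does not subdivide the cells of the original mesh. -/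
lemma exists_cell_subset (h : IsGridExtension T Te X Y) (hc : c ∈ T.cells) :
    ∃ d ∈ Te.cells, c.toSet ⊆ d.toSet := by
  obtain ⟨mx, hmx⟩ : (Ioo c.xmin c.xmax).Nonempty := nonempty_Ioo.2 c.hx
  obtain ⟨my, hmy⟩ : (Ioo c.ymin c.ymax).Nonempty := nonempty_Ioo.2 c.hy
  obtain ⟨d, hd, hdx, hdy⟩ := Te.exists_cell (z := (mx, my)) (h.outer_subset
    (T.toSet_subset_outer hc ⟨Ioo_subset_Icc_self hmx, Ioo_subset_Icc_self hmy⟩))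
  have hno : ∀ z ∈ interior c.toSet, z ∈ d.toSet →
      ¬ ((z.1 = d.xmin ∨ z.1 = d.xmax) ∨ (z.2 = d.ymin ∨ z.2 = d.ymax)) := fun z hz hz' he =>
    h.notMem_skeleton_of_mem_interior hc hz
      (TMesh.mem_skeleton.2 ⟨d, hd, Rect.mem_frontier_toSet.2 ⟨hz', he⟩⟩)
  rw [Rect.interior_toSet] at hno
  refine ⟨d, hd, prod_mono (Icc_subset_Icc ?_ ?_) (Icc_subset_Icc ?_ ?_)⟩
  · by_contra! hlt
    exact hno (d.xmin, my) ⟨⟨hlt, hdx.1.trans_lt hmx.2⟩, hmy⟩ ⟨⟨le_rfl, d.hx.le⟩, hdy⟩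
      (Or.inl (Or.inl rfl))
  · by_contra! hlt
    exact hno (d.xmax, my) ⟨⟨hmx.1.trans_le hdx.2, hlt⟩, hmy⟩ ⟨⟨d.hx.le, le_rfl⟩, hdy⟩
      (Or.inl (Or.inr rfl))
  · by_contra! hlt
    exact hno (mx, d.ymin) ⟨hmx, ⟨hlt, hdy.1.trans_lt hmy.2⟩⟩ ⟨hdx, ⟨le_rfl, d.hy.le⟩⟩
      (Or.inr (Or.inl rfl))
  · by_contra! hlt
    exact hno (mx, d.ymax) ⟨hmx, ⟨hmy.1.trans_le hdy.2, hlt⟩⟩ ⟨hdx, ⟨d.hy.le, le_rfl⟩⟩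
      (Or.inr (Or.inr rfl))

/-- Away from finitely many heights, the cells of the extension beside `Ω` span a full column of
the grid. -/
lemma exists_cell_fst (h : IsGridExtension T Te X Y) {i : ℕ} (hi : i < 5) (hi2 : i ≠ 2) {y : ℝ}
    (hy : y ∈ Icc (Y 0) (Y 5)) (hyT : y ∉ T.heights) (hyY : ∀ j ≤ 5, y ≠ Y j) :
    ∃ c ∈ Te.cells, Icc (X i) (X (i + 1)) ⊆ Icc c.xmin c.xmax ∧ y ∈ Icc c.ymin c.ymax := by
  obtain ⟨m, hm⟩ : (Ioo (X i) (X (i + 1))).Nonempty := nonempty_Ioo.2 (h.hX i hi)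
  have hm0 : m ∈ Icc (X 0) (X 5) :=
    ⟨(grid_le h.hX (Nat.zero_le i) hi.le).trans hm.1.le, hm.2.le.trans (grid_le h.hX hi le_rfl)⟩
  obtain ⟨c, hc, hcx, hcy⟩ := Te.exists_cell (z := (m, y))
    ⟨by rwa [h.xmin', h.xmax'], by rwa [h.ymin', h.ymax']⟩
  have hno : ∀ e ∈ Ioo (X i) (X (i + 1)), (e, y) ∉ Te.skeleton := by
    intro e he
    have he' := disjoint_Ioo_grid_middle h.hX hi hi2 he
    rw [h.xmin, h.xmax] at he'
    rw [h.skeleton]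
    rintro ((hs | ⟨⟨k, hk, hzk⟩, -⟩ | ⟨⟨k, hk, hzk⟩, -⟩) | hs)
    · exact he' (T.skeleton_subset hs).1
    · exact grid_notMem_Ioo h.hX hi hk (hzk ▸ he)
    · exact hyY k hk hzk
    · rcases extSegs_cases hs with ⟨h', -⟩ | ⟨h', -⟩
      · exact hyT h'
      · exact he' (T.abscissae_subset h')
  have hfr : ∀ e, e ∈ Icc c.xmin c.xmax → e = c.xmin ∨ e = c.xmax → (e, y) ∈ Te.skeleton :=
    fun e hmem he => TMesh.mem_skeleton.2
      ⟨c, hc, Rect.mem_frontier_toSet.2 ⟨⟨hmem, hcy⟩, Or.inl he⟩⟩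
  refine ⟨c, hc, Icc_subset_Icc ?_ ?_, hcy⟩
  · by_contra! hlt
    exact hno _ ⟨hlt, hcx.1.trans_lt hm.2⟩ (hfr _ ⟨le_rfl, c.hx.le⟩ (Or.inl rfl))
  · by_contra! hlt
    exact hno _ ⟨hm.1.trans_le hcx.2, hlt⟩ (hfr _ ⟨c.hx.le, le_rfl⟩ (Or.inr rfl))

/-- Away from finitely many abscissae, the cells of the extension above and below `Ω` span a full
row of the grid. -/
lemma exists_cell_snd (h : IsGridExtension T Te X Y) {j : ℕ} (hj : j < 5) (hj2 : j ≠ 2) {x : ℝ}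
    (hx : x ∈ Icc (X 0) (X 5)) (hxT : x ∉ T.abscissae) (hxX : ∀ i ≤ 5, x ≠ X i) :
    ∃ c ∈ Te.cells, Icc (Y j) (Y (j + 1)) ⊆ Icc c.ymin c.ymax ∧ x ∈ Icc c.xmin c.xmax := by
  obtain ⟨m, hm⟩ : (Ioo (Y j) (Y (j + 1))).Nonempty := nonempty_Ioo.2 (h.hY j hj)
  have hm0 : m ∈ Icc (Y 0) (Y 5) :=
    ⟨(grid_le h.hY (Nat.zero_le j) hj.le).trans hm.1.le, hm.2.le.trans (grid_le h.hY hj le_rfl)⟩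
  obtain ⟨c, hc, hcx, hcy⟩ := Te.exists_cell (z := (x, m))
    ⟨by rwa [h.xmin', h.xmax'], by rwa [h.ymin', h.ymax']⟩
  have hno : ∀ e ∈ Ioo (Y j) (Y (j + 1)), (x, e) ∉ Te.skeleton := by
    intro e he
    have he' := disjoint_Ioo_grid_middle h.hY hj hj2 he
    rw [h.ymin, h.ymax] at he'
    rw [h.skeleton]
    rintro ((hs | ⟨⟨k, hk, hzk⟩, -⟩ | ⟨⟨k, hk, hzk⟩, -⟩) | hs)
    · exact he' (T.skeleton_subset hs).2
    · exact hxX k hk hzk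
    · exact grid_notMem_Ioo h.hY hj hk (hzk ▸ he)
    · rcases extSegs_cases hs with ⟨h', -⟩ | ⟨h', -⟩
      · exact he' (T.heights_subset h')
      · exact hxT h'
  have hfr : ∀ e, e ∈ Icc c.ymin c.ymax → e = c.ymin ∨ e = c.ymax → (x, e) ∈ Te.skeleton :=
    fun e hmem he => TMesh.mem_skeleton.2
      ⟨c, hc, Rect.mem_frontier_toSet.2 ⟨⟨hcx, hmem⟩, Or.inr he⟩⟩
  refine ⟨c, hc, Icc_subset_Icc ?_ ?_, hcx⟩
  · by_contra! hlt
    exact hno _ ⟨hlt, hcy.1.trans_lt hm.2⟩ (hfr _ ⟨le_rfl, c.hy.le⟩ (Or.inl rfl))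
  · by_contra! hlt
    exact hno _ ⟨hm.1.trans_le hcy.2, hlt⟩ (hfr _ ⟨c.hy.le, le_rfl⟩ (Or.inr rfl))

end IsGridExtension

/-! ### The spaces `S(2,2,1,1,T)` and `S̄(2,2,1,1,T)` -/

lemma mem_SOn_iff {T : TMesh} {f : ℝ × ℝ → ℝ} : f ∈ SOn 2 2 1 1 T ↔
    (∀ c ∈ T.cells, BiquadOn f c.toSet) ∧ ∃ f1 f2 f12, HasPartialsOn T.outer.toSet f f1 f2 f12 :=
  and_congr piecewisePoly_two_two_iff (smoothWithin_one_one_iff (convex_Icc _ _) (convex_Icc _ _)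
    (uniqueDiffOn_Icc T.outer.hx) (uniqueDiffOn_Icc T.outer.hy) f)

lemma mem_SBar_iff {T : TMesh} {f : ℝ × ℝ → ℝ} : f ∈ SBar 2 2 1 1 T ↔
    (∀ p ∉ T.outer.toSet, f p = 0) ∧ (∀ c ∈ T.cells, BiquadOn f c.toSet) ∧
      ∃ f1 f2 f12, HasPartialsOn univ f f1 f2 f12 := by
  refine and_congr Iff.rfl (and_congr piecewisePoly_two_two_iff ?_)
  simpa only [univ_prod_univ] using smoothWithin_one_one_iff convex_univ convex_univ
    uniqueDiffOn_univ uniqueDiffOn_univ f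

/-- `S̄(2,2,1,1,T)` as a linear space. -/
def splineBar (T : TMesh) : Submodule ℝ (ℝ × ℝ → ℝ) where
  carrier := SBar 2 2 1 1 T
  zero_mem' := mem_SBar_iff.2
    ⟨fun _ _ => rfl, fun _ _ => BiquadOn.zero, 0, 0, 0, HasPartialsOn.zero⟩
  add_mem' := fun {f g} hf hg => by
    obtain ⟨f0, fq, f1, f2, f12, hf⟩ := mem_SBar_iff.1 hf
    obtain ⟨g0, gq, g1, g2, g12, hg⟩ := mem_SBar_iff.1 hg
    exact mem_SBar_iff.2 ⟨fun p hp => by simp [f0 p hp, g0 p hp],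
      fun c hc => (fq c hc).add (gq c hc), _, _, _, hf.add hg⟩
  smul_mem' := fun a f hf => by
    obtain ⟨f0, fq, f1, f2, f12, hf⟩ := mem_SBar_iff.1 hf
    exact mem_SBar_iff.2 ⟨fun p hp => by simp [f0 p hp],
      fun c hc => (fq c hc).const_smul a, _, _, _, hf.const_smul a⟩

lemma hasDim_SBar_iff_hasDimOn_SOn {T Te : TMesh}
    (hres : ∀ fb ∈ SBar 2 2 1 1 Te, fb ∈ SOn 2 2 1 1 T)
    (hext : ∀ f ∈ SOn 2 2 1 1 T, ∃ fb ∈ SBar 2 2 1 1 Te, EqOn fb f T.Omega)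
    (hinj : ∀ fb ∈ SBar 2 2 1 1 Te, ∀ gb ∈ SBar 2 2 1 1 Te, EqOn fb gb T.Omega → fb = gb)
    (d : ℕ) : HasDim (SBar 2 2 1 1 Te) d ↔ HasDimOn T.Omega (SOn 2 2 1 1 T) d := by
  have hsum : ∀ {b : Fin d → ℝ × ℝ → ℝ}, (∀ i, b i ∈ SBar 2 2 1 1 Te) → ∀ g : Fin d → ℝ,
      ∑ i, g i • b i ∈ SBar 2 2 1 1 Te := fun hb g =>
    (splineBar Te).sum_mem fun i _ => (splineBar Te).smul_mem (g i) (hb i)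
  constructor
  · rintro ⟨b, hb, hli, hspan⟩
    refine ⟨b, fun i => hres _ (hb i), ?_, fun f hf => ?_⟩
    · rw [Fintype.linearIndependent_iff] at hli ⊢
      intro g hg
      refine hli g (hinj _ (hsum hb g) _ (splineBar Te).zero_mem fun z hz => ?_)
      have hz' := congrFun hg ⟨z, hz⟩
      rw [Finset.sum_apply] at hz'
      rw [Finset.sum_apply]
      exact hz'
    · obtain ⟨fb, hfb, e⟩ := hext f hf
      obtain ⟨c, rfl⟩ := hspan fb hfb
      exact ⟨c, e.symm⟩
  · rintro ⟨b, hb, hli, hspan⟩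
    choose B hB e using fun i => hext (b i) (hb i)
    have hBb : ∀ g : Fin d → ℝ, EqOn (∑ i, g i • B i) (∑ i, g i • b i) T.Omega := fun g z hz => by
      simp only [Finset.sum_apply, Pi.smul_apply, e _ hz]
    refine ⟨B, hB, ?_, fun f hf => ?_⟩
    · rw [Fintype.linearIndependent_iff] at hli ⊢
      intro g hg
      refine hli g (funext fun z => ?_)
      have hz := hBb g z.2
      rw [hg, Finset.sum_apply] at hz
      rw [Finset.sum_apply]
      exact hz.symm
    · obtain ⟨c, hc⟩ := hspan f (hres f hf)
      exact ⟨c, hinj _ hf _ (hsum hB c) (hc.trans (hBb c).symm)⟩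

/-! ### Restriction, extension and uniqueness -/

namespace IsGridExtension

variable {T Te : TMesh} {X Y : ℕ → ℝ}

lemma mem_SOn_of_mem_SBar (h : IsGridExtension T Te X Y) {f : ℝ × ℝ → ℝ}
    (hf : f ∈ SBar 2 2 1 1 Te) : f ∈ SOn 2 2 1 1 T := by
  obtain ⟨-, hq, f1, f2, f12, hf⟩ := mem_SBar_iff.1 hf
  refine mem_SOn_iff.2 ⟨fun c hc => ?_, f1, f2, f12, hf.mono (subset_univ _)⟩
  obtain ⟨d, hd, hcd⟩ := h.exists_cell_subset hc
  exact (hq d hd).mono hcd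

lemma exists_mem_SBar_eqOn (h : IsGridExtension T Te X Y) {f : ℝ × ℝ → ℝ}
    (hf : f ∈ SOn 2 2 1 1 T) : ∃ g ∈ SBar 2 2 1 1 Te, EqOn g f T.Omega := by
  obtain ⟨hq, f1, f2, f12, hf⟩ := mem_SOn_iff.1 hf
  have hO : T.outer.toSet = Icc (X 2) (X 3) ×ˢ Icc (Y 2) (Y 3) := by
    rw [h.xmin, h.xmax, h.ymin, h.ymax, Rect.toSet]
  rw [hO] at hf
  obtain ⟨F, F1, F2, F12, hF, hFf, hF0, -, hFq⟩ := exists_extension_fst h.hX isClosed_Icc hf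
  have hFs := hF.swap
  rw [preimage_swap_prod] at hFs
  obtain ⟨G, G1, G2, G12, hG, hGF, hG0, hGF0, hGq⟩ := exists_extension_fst h.hY isClosed_univ hFs
  have hGs := hG.swap
  rw [preimage_swap_prod, univ_prod_univ] at hGs
  refine ⟨G ∘ Prod.swap, mem_SBar_iff.2 ⟨?_, fun c hc => ?_, _, _, _, hGs⟩, ?_⟩
  · rintro ⟨x, y⟩ hp
    rw [Rect.mem_toSet, h.xmin', h.xmax', h.ymin', h.ymax', not_and_or] at hp
    rcases hp with hx | hy
    · have hx' : x ≤ X 0 ∨ X 5 ≤ x := by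
        by_contra! hx'
        exact hx ⟨hx'.1.le, hx'.2.le⟩
      exact hGF0 x (fun y _ => hF0 x y hx') y
    · have hy' : y ≤ Y 0 ∨ Y 5 ≤ y := by
        by_contra! hy'
        exact hy ⟨hy'.1.le, hy'.2.le⟩
      exact (hG0 y x hy').1
  · obtain ⟨d, hd, hx1, hx2, hy1, hy2⟩ := h.clampTo_mem_cell hc
    obtain ⟨i, hi, hci⟩ := h.exists_grid_Icc_fst hc
    obtain ⟨j, hj, hcj⟩ := h.exists_grid_Icc_snd hc
    obtain ⟨d1, d2, d3, d4⟩ := T.cell_bounds hd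
    rw [← h.xmin] at d1
    rw [← h.xmax] at d2
    rw [← h.ymin] at d3
    rw [← h.ymax] at d4
    have hFd := hFq i hi _ _ c.hx.le hci _ _ d.hx (Icc_subset_Icc d1 d2) _
      (Icc_subset_Icc d3 d4) hx1 hx2 (hq d hd)
    have hFds := hFd.swap
    rw [preimage_swap_prod] at hFds
    have hGc := (hGq j hj _ _ c.hy.le hcj _ _ d.hy (Icc_subset_Icc d3 d4) _
      (subset_univ _) hy1 hy2 hFds).swap
    rwa [preimage_swap_prod] at hGc
  · rintro ⟨x, y⟩ hz
    rw [TMesh.Omega, hO] at hz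
    exact (hGF y hz.2 x).trans (hFf x hz.1 y)

end IsGridExtension

/-- A quadratic function vanishing to second order at `x₀` is a multiple of `(x - x₀) ^ 2`. -/
lemma QuadOn.exists_eq_mul_sq {u u' : ℝ → ℝ} {a b x₀ : ℝ} (h : QuadOn u (Icc a b)) (hab : a < b)
    (hd : ∀ x, HasDerivAt u (u' x) x) (hx₀ : x₀ ∈ Icc a b) (h0 : u x₀ = 0) (h0' : u' x₀ = 0) :
    ∃ k, ∀ x ∈ Icc a b, u x = k * (x - x₀) ^ 2 ∧ u' x = k * (2 * (x - x₀)) := by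
  obtain ⟨c, hc⟩ := h
  have hc' : ∀ x ∈ Icc a b, u x = c 0 + c 1 * x + c 2 * x ^ 2 := fun x hx => by
    simpa [Fin.sum_univ_three] using hc x hx
  have hu' : ∀ x ∈ Icc a b, u' x = c 1 + c 2 * (2 * x) := fun x hx => by
    refine (uniqueDiffOn_Icc hab x hx).eq_deriv _ (hd x).hasDerivWithinAt ?_
    have hp : HasDerivAt (fun x => c 0 + c 1 * x + c 2 * x ^ 2) (c 1 + c 2 * (2 * x)) x := by
      have := (((hasDerivAt_id x).const_mul (c 1)).const_add (c 0)).add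
        (((hasDerivAt_id x).pow 2).const_mul (c 2))
      exact this.congr_deriv (by simp)
    exact hp.hasDerivWithinAt.congr hc' (hc' x hx)
  rw [hc' x₀ hx₀] at h0
  rw [hu' x₀ hx₀] at h0'
  refine ⟨c 2, fun x hx => ⟨?_, ?_⟩⟩
  · rw [hc' x hx]
    linear_combination h0 + (x - x₀) * h0'
  · rw [hu' x hx]
    linear_combination h0'

/-- A `C¹` piecewise quadratic function with one knot that vanishes to second order at both ends
is zero. -/
lemma eq_zero_of_quadOn_of_quadOn {u u' : ℝ → ℝ} {a b c : ℝ} (hab : a < b) (hbc : b < c)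
    (hd : ∀ x, HasDerivAt u (u' x) x) (h1 : QuadOn u (Icc a b)) (h2 : QuadOn u (Icc b c))
    (ha : u a = 0) (ha' : u' a = 0) (hc : u c = 0) (hc' : u' c = 0) :
    ∀ x ∈ Icc a c, u x = 0 := by
  obtain ⟨k, hk⟩ := h1.exists_eq_mul_sq hab hd ⟨le_rfl, hab.le⟩ ha ha'
  obtain ⟨l, hl⟩ := h2.exists_eq_mul_sq hbc hd ⟨hbc.le, le_rfl⟩ hc hc'
  have e1 := (hk b ⟨hab.le, le_rfl⟩).1.symm.trans (hl b ⟨le_rfl, hbc.le⟩).1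
  have e2 := (hk b ⟨hab.le, le_rfl⟩).2.symm.trans (hl b ⟨le_rfl, hbc.le⟩).2
  have hne : (c - a) ≠ 0 := by linarith
  have hl0 : l = 0 := by
    have : l * ((b - c) * (c - a)) = 0 := by linear_combination e1 - (b - a) / 2 * e2
    exact (mul_eq_zero.1 this).resolve_right (mul_ne_zero (by linarith) hne)
  have hk0 : k = 0 := by
    rw [hl0, zero_mul] at e2
    exact (mul_eq_zero.1 e2).resolve_right (by linarith)
  intro x hx
  rcases le_total x b with h | h
  · rw [(hk x ⟨hx.1, h⟩).1, hk0, zero_mul]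
  · rw [(hl x ⟨h, hx.2⟩).1, hl0, zero_mul]

/-- A `C¹` piecewise quadratic function supported in `[X 0, X 5]` and vanishing on the middle
interval is zero. -/
lemma eq_zero_of_quadOn_grid {X : ℕ → ℝ} (hX : ∀ i < 5, X i < X (i + 1)) {u u' : ℝ → ℝ}
    (hd : ∀ x, HasDerivAt u (u' x) x) (hout : ∀ x ∉ Icc (X 0) (X 5), u x = 0)
    (hmid : ∀ x ∈ Icc (X 2) (X 3), u x = 0)
    (hq : ∀ i < 5, i ≠ 2 → QuadOn u (Icc (X i) (X (i + 1)))) (x : ℝ) : u x = 0 := by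
  have h01 : X 0 < X 1 := hX 0 (by norm_num)
  have h12 : X 1 < X 2 := hX 1 (by norm_num)
  have h23 : X 2 < X 3 := hX 2 (by norm_num)
  have h34 : X 3 < X 4 := hX 3 (by norm_num)
  have h45 : X 4 < X 5 := hX 4 (by norm_num)
  have hcont : Continuous u := continuous_iff_continuousAt.2 fun x => (hd x).continuousAt
  have hclosed : IsClosed {x | u x = 0} := isClosed_eq hcont continuous_const
  have hle : ∀ x ∈ Iic (X 0), u x = 0 := by
    rw [← closure_Iio' (nonempty_Iio (a := X 0))]
    exact closure_minimal (fun x hx => hout x fun h => h.1.not_gt hx) hclosed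
  have hge : ∀ x ∈ Ici (X 5), u x = 0 := by
    rw [← closure_Ioi' (nonempty_Ioi (a := X 5))]
    exact closure_minimal (fun x hx => hout x fun h => h.2.not_gt hx) hclosed
  have hder : ∀ {s : Set ℝ} {x : ℝ}, UniqueDiffWithinAt ℝ s x → x ∈ s → (∀ t ∈ s, u t = 0) →
      u' x = 0 := fun hs hx h0 => hs.eq_deriv _ (hd _).hasDerivWithinAt
    ((hasDerivWithinAt_const _ _ (0 : ℝ)).congr h0 (h0 _ hx))
  have hm2 : X 2 ∈ Icc (X 2) (X 3) := ⟨le_rfl, h23.le⟩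
  have hm3 : X 3 ∈ Icc (X 2) (X 3) := ⟨h23.le, le_rfl⟩
  have hleft := eq_zero_of_quadOn_of_quadOn h01 h12 hd (hq 0 (by norm_num) (by norm_num))
    (hq 1 (by norm_num) (by norm_num)) (hle _ self_mem_Iic)
    (hder (uniqueDiffOn_Iic (X 0) _ self_mem_Iic) self_mem_Iic hle) (hmid _ hm2)
    (hder (uniqueDiffOn_Icc h23 _ hm2) hm2 hmid)
  have hright := eq_zero_of_quadOn_of_quadOn h34 h45 hd (hq 3 (by norm_num) (by norm_num))
    (hq 4 (by norm_num) (by norm_num)) (hmid _ hm3)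
    (hder (uniqueDiffOn_Icc h23 _ hm3) hm3 hmid) (hge _ self_mem_Ici)
    (hder (uniqueDiffOn_Ici (X 5) _ self_mem_Ici) self_mem_Ici hge)
  by_cases hx0 : x < X 0
  · exact hle x hx0.le
  by_cases hx2 : x ≤ X 2
  · exact hleft x ⟨not_lt.1 hx0, hx2⟩
  by_cases hx3 : x ≤ X 3
  · exact hmid x ⟨(not_le.1 hx2).le, hx3⟩
  by_cases hx5 : x ≤ X 5
  · exact hright x ⟨(not_le.1 hx3).le, hx5⟩
  · exact hge x (not_le.1 hx5).le

/-- A continuous function vanishing off a finite set on an open interval vanishes on its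
closure. -/
lemma eq_zero_on_Icc_of_finite {u : ℝ → ℝ} (hu : Continuous u) {s : Set ℝ} (hs : s.Finite)
    {a b : ℝ} (hab : a < b) (h : ∀ x ∈ Ioo a b, x ∉ s → u x = 0) : ∀ x ∈ Icc a b, u x = 0 := by
  have hclosed : IsClosed {x | u x = 0} := isClosed_eq hu continuous_const
  have hdense : Dense sᶜ := hs.countable.dense_compl ℝ
  rw [← closure_Ioo hab.ne]
  refine closure_minimal (((hdense.open_subset_closure_inter isOpen_Ioo).trans
    (closure_minimal (fun x hx => h x hx.1 hx.2) hclosed))) hclosed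

namespace IsGridExtension

variable {T Te : TMesh} {X Y : ℕ → ℝ}

lemma eq_zero_of_mem_SBar (h : IsGridExtension T Te X Y) {f : ℝ × ℝ → ℝ}
    (hf : f ∈ SBar 2 2 1 1 Te) (hΩ : ∀ z ∈ T.outer.toSet, f z = 0) : f = 0 := by
  obtain ⟨hout, hq, f1, f2, f12, hf⟩ := mem_SBar_iff.1 hf
  have hcont : Continuous f := continuousOn_univ.1 hf.cont
  have hdx : ∀ x y, HasDerivAt (fun x => f (x, y)) (f1 (x, y)) x := fun x y => by
    simpa using hf.dx (x, y) (mem_univ _)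
  have hdy : ∀ x y, HasDerivAt (fun y => f (x, y)) (f2 (x, y)) y := fun x y => by
    simpa using hf.dy (x, y) (mem_univ _)
  simp only [Rect.mem_toSet, h.xmin', h.xmax', h.ymin', h.ymax', not_and_or] at hout
  simp only [Rect.mem_toSet, ← h.xmin, ← h.xmax, ← h.ymin, ← h.ymax] at hΩ
  have hX0 : Icc (X 2) (X 3) ⊆ Icc (X 0) (X 5) :=
    Icc_subset_Icc (grid_le h.hX (by norm_num) (by norm_num))
      (grid_le h.hX (by norm_num) (by norm_num))
  have hY0 : Icc (Y 2) (Y 3) ⊆ Icc (Y 0) (Y 5) :=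
    Icc_subset_Icc (grid_le h.hY (by norm_num) (by norm_num))
      (grid_le h.hY (by norm_num) (by norm_num))
  have hstrip : ∀ x, ∀ y ∈ Icc (Y 2) (Y 3), f (x, y) = 0 := by
    intro x
    refine eq_zero_on_Icc_of_finite (by fun_prop)
      (T.finite_heights.union ((finite_Iic 5).image Y)) (h.hY 2 (by norm_num)) fun y hy hgen => ?_
    have hy' := Ioo_subset_Icc_self hy
    refine eq_zero_of_quadOn_grid h.hX (fun x => hdx x y) (fun x hx => hout _ (Or.inl hx))
      (fun x hx => hΩ (x, y) ⟨hx, hy'⟩) (fun i hi hi2 => ?_) x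
    obtain ⟨c, hc, hcx, hcy⟩ := h.exists_cell_fst hi hi2 (hY0 hy') (fun h' => hgen (Or.inl h'))
      fun j hj e => hgen (Or.inr ⟨j, hj, e.symm⟩)
    exact ((hq c hc).quadOn_fst hcy).mono hcx
  have hX05 : X 0 < X 5 := (h.hX 0 (by norm_num)).trans_le (grid_le h.hX (by norm_num) le_rfl)
  funext ⟨x, y⟩
  by_cases hx : x ∈ Icc (X 0) (X 5)
  · refine eq_zero_on_Icc_of_finite (u := fun x => f (x, y)) (by fun_prop)
      (T.finite_abscissae.union ((finite_Iic 5).image X)) hX05 (fun x hx hgen => ?_) x hx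
    refine eq_zero_of_quadOn_grid h.hY (hdy x) (fun y hy => hout _ (Or.inr hy)) (hstrip x)
      (fun j hj hj2 => ?_) y
    obtain ⟨c, hc, hcy, hcx⟩ := h.exists_cell_snd hj hj2 (Ioo_subset_Icc_self hx)
      (fun h' => hgen (Or.inl h')) fun i hi e => hgen (Or.inr ⟨i, hi, e.symm⟩)
    exact ((hq c hc).quadOn_snd hcx).mono hcy
  · exact hout _ (Or.inl hx)

lemma eq_of_eqOn (h : IsGridExtension T Te X Y) {f g : ℝ × ℝ → ℝ} (hf : f ∈ SBar 2 2 1 1 Te)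
    (hg : g ∈ SBar 2 2 1 1 Te) (e : EqOn f g T.Omega) : f = g :=
  sub_eq_zero.1 (h.eq_zero_of_mem_SBar ((splineBar Te).sub_mem hf hg)
    fun _ hz => sub_eq_zero.2 (e hz))

end IsGridExtension

/-- **Theorem (extension).** For a regular T-mesh `T` and an extension `Te` of `T` associated
with `S(2,2,1,1,T)`: `S(2,2,1,1,T)` equals the set of restrictions to `Ω` of elements of
`S̄(2,2,1,1,Te)`, the restriction map is bijective (hence a linear isomorphism), and
`dim S(2,2,1,1,T) = dim S̄(2,2,1,1,Te)`. -/
theorem extension_restriction_iso (T Te : TMesh) (hext : IsExtensionOf 2 2 T Te) :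
    (∀ fb ∈ SBar 2 2 1 1 Te, fb ∈ SOn 2 2 1 1 T) ∧
    (∀ f ∈ SOn 2 2 1 1 T, ∃ fb ∈ SBar 2 2 1 1 Te, Set.EqOn fb f T.Omega) ∧
    (∀ fb ∈ SBar 2 2 1 1 Te, ∀ gb ∈ SBar 2 2 1 1 Te, Set.EqOn fb gb T.Omega → fb = gb) ∧
    (∀ d : ℕ, HasDim (SBar 2 2 1 1 Te) d ↔ HasDimOn T.Omega (SOn 2 2 1 1 T) d) := by
  obtain ⟨X, Y, h⟩ := hext.exists_isGridExtension
  have hres : ∀ fb ∈ SBar 2 2 1 1 Te, fb ∈ SOn 2 2 1 1 T := fun _ => h.mem_SOn_of_mem_SBar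
  have hexists : ∀ f ∈ SOn 2 2 1 1 T, ∃ fb ∈ SBar 2 2 1 1 Te, EqOn fb f T.Omega :=
    fun _ => h.exists_mem_SBar_eqOn
  have hinj : ∀ fb ∈ SBar 2 2 1 1 Te, ∀ gb ∈ SBar 2 2 1 1 Te, EqOn fb gb T.Omega → fb = gb :=
    fun _ hf _ hg => h.eq_of_eqOn hf hg
  exact ⟨hres, hexists, hinj, hasDim_SBar_iff_hasDimOn_SOn hres hexists hinj⟩
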